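/- There exists a nonzero polynomial P in the 15 coefficients of a plane quartic with the following property: for any two smooth plane quartics F, G ∈ ℂ[x₀, x₁, x₂] (homogeneous of degree 4) whose coefficient vectors satisfy P ≠ 0, if F and G have the same set of bitangent lines in ℙ²(ℂ), then G = c·F for some nonzero c ∈ ℂ. (The general plane quartic is uniquely determined by its 28 bitangent lines.) -/

import Mathlib

open scoped BigOperators
open Complex Matrix

noncomputable section

/-- The Siegel upper half-space: complex symmetric `g × g` matrices with
positive definite imaginary part. -/
def IsSiegel {g : ℕ} (τ : Matrix (Fin g) (Fin g) ℂ) : Prop :=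
  τ.IsSymm ∧ Matrix.PosDef (Matrix.of fun i j => (τ i j).im)

/-- The `p`-th term of the Riemann theta series with characteristic `m`. -/
def thetaTerm {g : ℕ} (m : (Fin g → ℤ) × (Fin g → ℤ))
    (τ : Matrix (Fin g) (Fin g) ℂ) (z : Fin g → ℂ) (p : Fin g → ℤ) : ℂ :=
  Complex.exp ((Real.pi : ℂ) * Complex.I *
      (∑ i, ∑ j, ((p i : ℂ) + (m.1 i : ℂ) / 2) * τ i j * ((p j : ℂ) + (m.1 j : ℂ) / 2))
    + 2 * (Real.pi : ℂ) * Complex.I *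
      (∑ i, ((p i : ℂ) + (m.1 i : ℂ) / 2) * (z i + (m.2 i : ℂ) / 2)))

/-- The Riemann theta function with characteristic `m`. -/
def theta {g : ℕ} (m : (Fin g → ℤ) × (Fin g → ℤ))
    (τ : Matrix (Fin g) (Fin g) ℂ) (z : Fin g → ℂ) : ℂ :=
  ∑' p : Fin g → ℤ, thetaTerm m τ z p

/-- The gradient `grad_z θ_m(τ, z)|_{z = 0}`. -/
def thetaGrad {g : ℕ} (m : (Fin g → ℤ) × (Fin g → ℤ))
    (τ : Matrix (Fin g) (Fin g) ℂ) : Fin g → ℂ :=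
  fun j => fderiv ℂ (fun z => theta m τ z) 0 (Pi.single j 1)

/-- The Jacobian determinant `D(n₁, …, n_g)(τ)`. -/
def jacDet {g : ℕ} (n : Fin g → (Fin g → ℤ) × (Fin g → ℤ))
    (τ : Matrix (Fin g) (Fin g) ℂ) : ℂ :=
  ((Real.pi : ℂ) ^ g)⁻¹ * Matrix.det (Matrix.of fun i j => thetaGrad (n i) τ j)

/-- A characteristic mod 2 in genus `g`. -/
abbrev ThetaChar (g : ℕ) := (Fin g → ZMod 2) × (Fin g → ZMod 2)

/-- Lift of a mod-2 characteristic to the integer representative with entries in `{0,1}`. -/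
def charLift {g : ℕ} (m : ThetaChar g) : (Fin g → ℤ) × (Fin g → ℤ) :=
  (fun i => ((m.1 i).val : ℤ), fun i => ((m.2 i).val : ℤ))

/-- `m'·m''` computed on the `{0,1}` representatives. -/
def charDot {g : ℕ} (m : ThetaChar g) : ℕ := ∑ i, (m.1 i).val * (m.2 i).val

/-- The parity `e(m) = (-1)^{m'·m''}` of a characteristic. -/
def charParity {g : ℕ} (m : ThetaChar g) : ℤ := (-1) ^ charDot m

def IsOddChar {g : ℕ} (m : ThetaChar g) : Prop := charParity m = -1

def IsEvenChar {g : ℕ} (m : ThetaChar g) : Prop := charParity m = 1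

/-- A tuple of characteristics is azygetic if
`e(nᵢ)e(nⱼ)e(nₖ)e(nᵢ+nⱼ+nₖ) = -1` for all `i < j < k`. -/
def Azygetic {g k : ℕ} (n : Fin k → ThetaChar g) : Prop :=
  ∀ i j l : Fin k, i < j → j < l →
    charParity (n i) * charParity (n j) * charParity (n l) *
      charParity (n i + n j + n l) = -1

/-- An Aronhold set in genus 3: seven pairwise distinct odd characteristics such
that, together with their sum, they form an azygetic 8-tuple. -/
def IsAronhold (n : Fin 7 → ThetaChar 3) : Prop :=
  Function.Injective n ∧ (∀ i, IsOddChar (n i)) ∧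
    Azygetic (Fin.snoc n (∑ i, n i) : Fin 8 → ThetaChar 3)

/-- The standard symplectic form matrix `J = (0 I; -I 0)` over a ring. -/
def Jmat (g : ℕ) (R : Type*) [Ring R] :
    Matrix (Fin g ⊕ Fin g) (Fin g ⊕ Fin g) R :=
  Matrix.fromBlocks 0 1 (-1) 0

/-- The blocks `(a b; c d)` form a symplectic matrix over `R`. -/
def IsSymplectic {g : ℕ} {R : Type*} [Ring R]
    (a b c d : Matrix (Fin g) (Fin g) R) : Prop :=
  (Matrix.fromBlocks a b c d)ᵀ * Jmat g R * Matrix.fromBlocks a b c d = Jmat g R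

/-- The action of `Sp(2g, ℤ)` on mod-2 characteristics. -/
def charAction {g : ℕ} (a b c d : Matrix (Fin g) (Fin g) ℤ) (m : ThetaChar g) : ThetaChar g :=
  (fun i => (∑ j, ((d i j : ZMod 2)) * m.1 j) - (∑ j, ((c i j : ZMod 2)) * m.2 j)
      + (((c * dᵀ) i i : ℤ) : ZMod 2),
   fun i => -(∑ j, ((b i j : ZMod 2)) * m.1 j) + (∑ j, ((a i j : ZMod 2)) * m.2 j)
      + (((a * bᵀ) i i : ℤ) : ZMod 2))

/-- The Jacobian determinant in genus 3, for three mod-2 odd characteristics. -/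
def D3 (n1 n2 n3 : ThetaChar 3) (τ : Matrix (Fin 3) (Fin 3) ℂ) : ℂ :=
  jacDet ![charLift n1, charLift n2, charLift n3] τ

end

/-- A smooth plane quartic: a nonzero homogeneous polynomial of degree 4 in
three variables whose partial derivatives have no common zero in `ℂ³ ∖ {0}`. -/
def SmoothQuartic (F : MvPolynomial (Fin 3) ℂ) : Prop :=
  F ≠ 0 ∧ F.IsHomogeneous 4 ∧
    ∀ x : Fin 3 → ℂ, x ≠ 0 → ∃ i, MvPolynomial.eval x (MvPolynomial.pderiv i F) ≠ 0

/-- The line `{L·x = 0}` (given by a nonzero linear form `L`) is a bitangent of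
the quartic `F`: for a linear parametrization `(s, t) ↦ s·u + t·v` of the line,
the restricted binary quartic is the square of a binary quadratic form. -/
def IsBitangent (F : MvPolynomial (Fin 3) ℂ) (L : Fin 3 → ℂ) : Prop :=
  L ≠ 0 ∧ ∃ u v : Fin 3 → ℂ, LinearIndependent ℂ ![u, v] ∧
    (∑ i, L i * u i = 0) ∧ (∑ i, L i * v i = 0) ∧
    ∃ α β γ : ℂ, ∀ s t : ℂ,
      MvPolynomial.eval (fun i => s * u i + t * v i) F =
        (α * s ^ 2 + β * s * t + γ * t ^ 2) ^ 2

/-- A finitely generated extension of Noetherian domains is surjective on spectra over a nonempty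
basic open set. -/
theorem exists_forall_comap_eq {R B : Type*} [CommRing R] [IsNoetherianRing R] [IsDomain R]
    [CommRing B] [IsDomain B] [Algebra R B] [Algebra.FiniteType R B]
    (hinj : Function.Injective (algebraMap R B)) :
    ∃ f : R, f ≠ 0 ∧ ∀ p : PrimeSpectrum R, f ∉ p.asIdeal →
      ∃ q : PrimeSpectrum B, PrimeSpectrum.comap (algebraMap R B) q = p := by
  have hfp : (algebraMap R B).FinitePresentation :=
    RingHom.finitePresentation_algebraMap.mpr (Algebra.FinitePresentation.of_finiteType.mp ‹_›)
  obtain ⟨C, hC⟩ := PrimeSpectrum.exists_constructibleSetData_iff.mpr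
    (PrimeSpectrum.isConstructible_range_comap hfp)
  have hbot : (⟨⊥, Ideal.isPrime_bot⟩ : PrimeSpectrum R) ∈ C.toSet := by
    rw [hC]
    refine ⟨⟨⊥, Ideal.isPrime_bot⟩, ?_⟩
    ext r
    simp [map_eq_zero_iff _ hinj]
  simp only [PrimeSpectrum.ConstructibleSetData.toSet, Set.mem_iUnion] at hbot
  obtain ⟨c, hc, hg, hf⟩ := hbot
  refine ⟨c.f, fun h => hf (by simp [h]), fun p hp => ?_⟩
  have hg0 : ∀ i, c.g i = 0 := fun i => by
    have := hg (Set.mem_range_self i)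
    simpa using this
  have hp : p ∈ C.toSet := by
    simp only [PrimeSpectrum.ConstructibleSetData.toSet, Set.mem_iUnion]
    refine ⟨c, hc, ?_, ?_⟩
    · rintro _ ⟨i, rfl⟩
      simp [hg0]
    · simpa [PrimeSpectrum.mem_zeroLocus] using hp
  rw [hC] at hp
  exact hp

theorem exists_specialization_of_finiteType {D B : Type*} [Finite D] [CommRing B] [IsDomain B]
    [Algebra ℂ B] [Algebra (MvPolynomial D ℂ) B] [IsScalarTower ℂ (MvPolynomial D ℂ) B]
    [Algebra.FiniteType (MvPolynomial D ℂ) B]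
    (hinj : Function.Injective (algebraMap (MvPolynomial D ℂ) B)) :
    ∃ P : MvPolynomial D ℂ, P ≠ 0 ∧ ∀ x : D → ℂ, MvPolynomial.eval x P ≠ 0 →
      ∃ ψ : B →+* ℂ, ∀ r, ψ (algebraMap _ _ r) = MvPolynomial.eval x r := by
  obtain ⟨f, hf, H⟩ := exists_forall_comap_eq hinj
  refine ⟨f, hf, fun x hx => ?_⟩
  obtain ⟨q, hq⟩ := H ⟨RingHom.ker (MvPolynomial.eval x), RingHom.ker_isPrime _⟩
    (by simpa [RingHom.mem_ker] using hx)
  obtain ⟨M, hM, hqM⟩ := Ideal.exists_le_maximal q.asIdeal q.isPrime.ne_top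
  let := Ideal.Quotient.field M
  have : Algebra.FiniteType ℂ B := Algebra.FiniteType.trans (S := MvPolynomial D ℂ) inferInstance ‹_›
  have : Module.Finite ℂ (B ⧸ M) := finite_of_finite_type_of_isJacobsonRing ℂ (B ⧸ M)
  let θ : (B ⧸ M) →ₐ[ℂ] ℂ := IsAlgClosed.lift
  refine ⟨θ.toRingHom.comp (Ideal.Quotient.mk M), fun r => ?_⟩
  have hr : algebraMap (MvPolynomial D ℂ) B (r - MvPolynomial.C (MvPolynomial.eval x r)) ∈ M := by
    apply hqM
    have : r - MvPolynomial.C (MvPolynomial.eval x r) ∈ RingHom.ker (MvPolynomial.eval x) := by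
      simp [RingHom.mem_ker]
    have h3 := congrArg PrimeSpectrum.asIdeal hq
    simp only at h3
    rw [← h3] at this
    exact this
  rw [map_sub, ← Ideal.Quotient.eq] at hr
  have h2 : algebraMap (MvPolynomial D ℂ) B (MvPolynomial.C (MvPolynomial.eval x r))
      = algebraMap ℂ B (MvPolynomial.eval x r) :=
    (IsScalarTower.algebraMap_apply ℂ (MvPolynomial D ℂ) B _).symm
  rw [RingHom.comp_apply, hr, h2]
  exact θ.commutes (MvPolynomial.eval x r)

/-- Complex points outside a hypersurface lift along an injection of a polynomial ring into a
finitely generated algebra. -/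
theorem exists_specialization {D K : Type*} [Finite D] [Field K] (φ : MvPolynomial D ℂ →+* K)
    (hinj : Function.Injective φ) {S : Set K} (hS : S.Finite) :
    ∃ (B : Subring K) (P : MvPolynomial D ℂ), P ≠ 0 ∧ S ⊆ B ∧ (∀ r, φ r ∈ B) ∧
      ∀ x : D → ℂ, MvPolynomial.eval x P ≠ 0 →
      ∃ ψ : B →+* ℂ, ∀ (r : MvPolynomial D ℂ) (h : φ r ∈ B), ψ ⟨φ r, h⟩ = MvPolynomial.eval x r := by
  let := φ.toAlgebra
  let := (φ.comp MvPolynomial.C).toAlgebra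
  have : IsScalarTower ℂ (MvPolynomial D ℂ) K := IsScalarTower.of_algebraMap_eq fun _ => rfl
  let B := Algebra.adjoin (MvPolynomial D ℂ) S
  have : Algebra.FiniteType (MvPolynomial D ℂ) B :=
    (Subalgebra.fg_iff_finiteType _).mp ⟨hS.toFinset, by simp [B]⟩
  obtain ⟨P, hP, H⟩ := exists_specialization_of_finiteType (D := D) (B := B) (fun a b h =>
    hinj (congrArg (fun z : B => (z : K)) h))
  exact ⟨B.toSubring, P, hP, Algebra.subset_adjoin, fun r => B.algebraMap_mem r, fun x hx =>
    (H x hx).imp fun ψ hψ r h => hψ r⟩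

section Lines

variable {A B : Type*} [CommRing A] [CommRing B]

/-- The determinant of three vectors. -/
def tri (u v w : Fin 3 → A) : A :=
  u 0 * (v 1 * w 2 - v 2 * w 1) - u 1 * (v 0 * w 2 - v 2 * w 0) + u 2 * (v 0 * w 1 - v 1 * w 0)

/-- The linear form vanishing on two vectors. -/
def lineThrough (u v : Fin 3 → A) : Fin 3 → A :=
  ![u 1 * v 2 - u 2 * v 1, u 2 * v 0 - u 0 * v 2, u 0 * v 1 - u 1 * v 0]

/-- The determinant of the three lines `ij`, `kl`, `mn` of a configuration; it vanishes when they
are concurrent. -/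
def triLines (u : Fin 8 → Fin 8 → Fin 3 → A) (i j k l m n : Fin 8) : A :=
  tri (lineThrough (u i j) (u j i)) (lineThrough (u k l) (u l k)) (lineThrough (u m n) (u n m))

/-- The value of the binary quadratic form with coefficients `a i j, b i j, a j i` on the line `ij`
at its intersection with the line `kl`. -/
def evalMeet (u : Fin 8 → Fin 8 → Fin 3 → A) (a b : Fin 8 → Fin 8 → A) (i j k l : Fin 8) : A :=
  a i j * tri (u j i) (u k l) (u l k) ^ 2
    - b i j * tri (u j i) (u k l) (u l k) * tri (u i j) (u k l) (u l k)
    + a j i * tri (u i j) (u k l) (u l k) ^ 2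

theorem map_tri (φ : A →+* B) (u v w : Fin 3 → A) :
    φ (tri u v w) = tri (fun n => φ (u n)) (fun n => φ (v n)) (fun n => φ (w n)) := by
  simp [tri]

theorem map_evalMeet (φ : A →+* B) (u : Fin 8 → Fin 8 → Fin 3 → A) (a b : Fin 8 → Fin 8 → A)
    (i j k l : Fin 8) :
    φ (evalMeet u a b i j k l) =
      evalMeet (fun i j n => φ (u i j n)) (fun i j => φ (a i j)) (fun i j => φ (b i j)) i j k l := by
  simp [evalMeet, map_tri]

theorem map_triLines (φ : A →+* B) (u : Fin 8 → Fin 8 → Fin 3 → A) (i j k l m n : Fin 8) :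
    φ (triLines u i j k l m n) = triLines (fun i j n => φ (u i j n)) i j k l m n := by
  simp [triLines, tri, lineThrough]

theorem triLines_swap (u : Fin 8 → Fin 8 → Fin 3 → A) (i j k l m n : Fin 8) :
    triLines u k l i j m n = -triLines u i j k l m n := by
  simp only [triLines, tri]; ring

theorem triLines_rotate (u : Fin 8 → Fin 8 → Fin 3 → A) (i j k l m n : Fin 8) :
    triLines u k l m n i j = triLines u i j k l m n := by
  simp only [triLines, tri]; ring

theorem triLines_eq (u : Fin 8 → Fin 8 → Fin 3 → A) (i j k l m n : Fin 8) :
    triLines u i j k l m n = tri (u i j) (u k l) (u l k) * tri (u j i) (u m n) (u n m)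
      - tri (u j i) (u k l) (u l k) * tri (u i j) (u m n) (u n m) := by
  simp only [triLines, tri, lineThrough, Matrix.cons_val_zero, Matrix.cons_val_one,
    Matrix.cons_val]
  ring

end Lines

/-- Sign patterns on pairs of lines that do not depend on the orders involved. -/
def SignSymm (σ : Fin 8 → Fin 8 → Fin 8 → Fin 8 → ℤˣ) : Prop :=
  (∀ i j k l, σ i j k l = σ j i k l) ∧ ∀ i j k l, σ i j k l = σ k l i j

/-- Five lines of the configuration, no three concurrent, on which the sign pattern is a
coboundary. -/
def HasGoodClique {A : Type*} [CommRing A] (u : Fin 8 → Fin 8 → Fin 3 → A)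
    (σ : Fin 8 → Fin 8 → Fin 8 → Fin 8 → ℤˣ) : Prop :=
  ∃ (f g : Fin 5 → Fin 8) (e : Fin 5 → ℤˣ), (∀ a, f a ≠ g a) ∧
    (∀ a b, a ≠ b → σ (f a) (g a) (f b) (g b) = e a * e b) ∧
    ∀ a b c, a ≠ b → a ≠ c → b ≠ c → triLines u (f a) (g a) (f b) (g b) (f c) (g c) ≠ 0

section Core

open PowerSeries

variable {E : Type*} [Field E]

/-- The point `(1, t, t²) + X α (0, 1, 2t)`. -/
noncomputable def arcPoint (t : E) (α : E⟦X⟧) : Fin 3 → E⟦X⟧ :=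
  ![1, C t + X * α, C t ^ 2 + 2 * C t * (X * α)]

theorem tri_arcPoint_same (t : E) (α β : E⟦X⟧) (w : Fin 3 → E⟦X⟧) :
    tri (arcPoint t α) (arcPoint t β) w
      = X * ((β - α) * tri ![1, C t, C t ^ 2] ![0, 1, 2 * C t] w) := by
  simp [tri, arcPoint]; ring

theorem constantCoeff_tri_arcPoint (r s t : E) (α β γ : E⟦X⟧) :
    constantCoeff (tri (arcPoint r α) (arcPoint s β) (arcPoint t γ))
      = (s - r) * (t - r) * (t - s) := by
  simp [tri, arcPoint]; ring

theorem constantCoeff_tri_tangent (t s : E) (γ : E⟦X⟧) :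
    constantCoeff (tri ![1, C t, C t ^ 2] ![0, 1, 2 * C t] (arcPoint s γ)) = (s - t) ^ 2 := by
  have h2 : constantCoeff (2 : E⟦X⟧) = 2 := map_ofNat _ 2
  simp [tri, arcPoint, h2]; ring

/-- The configuration of secants of the conic near `τ`, with first order behaviour prescribed by
`g`. -/
structure SecantData (τ : Fin 8 → E) (α : Fin 8 → Fin 8 → E⟦X⟧) (g : Fin 8 → Fin 8 → E) : Prop where
  two : (2 : E) ≠ 0
  inj : Function.Injective τ
  ne : ∀ i j k, i ≠ j → i ≠ k → j ≠ k → g i j ≠ g i k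
  slope : ∀ i j k, i ≠ j → i ≠ k → j ≠ k →
    (constantCoeff (α i k) - constantCoeff (α i j)) * (2 * (τ j - τ i) * (τ k - τ i))
      = -(τ k - τ j) * (g i j + g i k)

variable {τ : Fin 8 → E} {α : Fin 8 → Fin 8 → E⟦X⟧} {g : Fin 8 → Fin 8 → E}

/-- The endpoints of the secants. -/
noncomputable def ends (τ : Fin 8 → E) (α : Fin 8 → Fin 8 → E⟦X⟧) (i j : Fin 8) : Fin 3 → E⟦X⟧ :=
  arcPoint (τ i) (α i j)

theorem SecantData.sub_ne (h : SecantData τ α g) {i j : Fin 8} (hij : i ≠ j) : τ j - τ i ≠ 0 :=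
  sub_ne_zero.mpr fun e => hij (h.inj e).symm

theorem SecantData.triLines_star (h : SecantData τ α g) {i j k l : Fin 8} (hj : i ≠ j)
    (hk : i ≠ k) (hl : i ≠ l) (hjk : j ≠ k) (hjl : j ≠ l) (hkl : k ≠ l) :
    triLines (ends τ α) i j i k i l ≠ 0 := by
  intro h0
  rw [triLines_eq] at h0
  simp only [ends, tri_arcPoint_same] at h0
  have h1 : (X : E⟦X⟧) * ((α i k - α i j) * tri ![1, C (τ i), C (τ i) ^ 2] ![0, 1, 2 * C (τ i)]
      (arcPoint (τ k) (α k i)) * tri (arcPoint (τ j) (α j i)) (arcPoint (τ i) (α i l))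
      (arcPoint (τ l) (α l i)) - (α i l - α i j) * tri ![1, C (τ i), C (τ i) ^ 2] ![0, 1, 2 * C (τ i)]
      (arcPoint (τ l) (α l i)) * tri (arcPoint (τ j) (α j i)) (arcPoint (τ i) (α i k))
      (arcPoint (τ k) (α k i))) = 0 := by
    linear_combination h0
  have h2 := congrArg constantCoeff ((mul_eq_zero.mp h1).resolve_left X_ne_zero)
  simp only [map_sub, map_mul, constantCoeff_tri_tangent, constantCoeff_tri_arcPoint,
    map_zero] at h2
  have s1 := h.slope i j k hj hk hjk
  have s2 := h.slope i j l hj hl hjl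
  have h3 : (τ k - τ i) * (τ l - τ i) * (τ k - τ j) * (τ l - τ j) * (g i l - g i k) = 0 := by
    linear_combination (-2) * h2 - (τ k - τ i) * (τ l - τ j) * (τ l - τ i) * s1
      + (τ l - τ i) * (τ k - τ j) * (τ k - τ i) * s2
  simp only [mul_eq_zero, h.sub_ne hk, h.sub_ne hl, h.sub_ne hjk, h.sub_ne hjl, false_or] at h3
  exact h.ne i k l hk hl hkl (sub_eq_zero.mp h3).symm

theorem SecantData.triLines_pair (h : SecantData τ α g) {i j k m n : Fin 8} (hj : i ≠ j)
    (hk : i ≠ k) (hjk : j ≠ k) (hm : i ≠ m) (hn : i ≠ n) (hmn : m ≠ n) :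
    triLines (ends τ α) i j i k m n ≠ 0 := by
  intro h0
  rw [triLines_eq] at h0
  have h2 := congrArg constantCoeff h0
  simp only [ends, tri_arcPoint_same, map_sub, map_mul, constantCoeff_tri_arcPoint, map_zero,
    constantCoeff_X, zero_mul, zero_sub, neg_eq_zero, mul_eq_zero, h.sub_ne hk, h.sub_ne hjk,
    h.sub_ne hm, h.sub_ne hn, h.sub_ne hmn, h.sub_ne hj.symm, or_self] at h2

end Core

section Signs

variable {F : Type*} [Field F]

theorem Int.units_mul_cast_self (e : ℤˣ) : ((e : ℤ) : F) * ((e : ℤ) : F) = 1 := by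
  rcases Int.units_eq_one_or e with h | h <;> simp [h]

theorem Int.units_cast_inj (h2 : (2 : F) ≠ 0) {x : F} (hx : x ≠ 0) {e e' : ℤˣ}
    (h : ((e : ℤ) : F) * x = ((e' : ℤ) : F) * x) : e = e' := by
  have h1 := mul_right_cancel₀ hx h
  have h3 : (1 : F) ≠ -1 := fun h => h2 (by linear_combination h)
  rcases Int.units_eq_one_or e with rfl | rfl <;> rcases Int.units_eq_one_or e' with rfl | rfl <;>
    simp_all

theorem Fin.exists_notMem_of_card_lt {s : Finset (Fin 8)} (hs : s.card < 8) : ∃ x, x ∉ s := by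
  by_contra! h
  have : s = Finset.univ := Finset.eq_univ_iff_forall.mpr h
  simp [this] at hs

/-- Solutions of the sign equations at a star: either all signs are negative, or some four of the
lines have pairwise positive signs. -/
theorem star_signs (i : Fin 8) (g c : Fin 8 → F) (s : Fin 8 → Fin 8 → ℤˣ)
    (hs : ∀ j k, s j k = s k j)
    (hg : ∀ j k, i ≠ j → i ≠ k → j ≠ k → g j ≠ g k)
    (hpos : ∀ j k, i ≠ j → i ≠ k → j ≠ k → s j k = 1 → c j = c k)
    (hneg : ∀ j k, i ≠ j → i ≠ k → j ≠ k → s j k = -1 → c j + c k = g j + g k) :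
    (∀ j k, i ≠ j → i ≠ k → j ≠ k → s j k = -1) ∨
      ∃ j : Fin 4 → Fin 8, Function.Injective j ∧ (∀ a, i ≠ j a) ∧
        ∀ a b, a ≠ b → s (j a) (j b) = 1 := by
  have trans : ∀ j k l, i ≠ j → i ≠ k → i ≠ l → j ≠ k → j ≠ l → k ≠ l → s j k = -1 →
      s j l = -1 → s k l = -1 := by
    intro j k l hj hk hl hjk hjl hkl e1 e2
    refine (Int.units_eq_one_or _).resolve_left fun e => hg k l hk hl hkl ?_
    linear_combination hneg j l hj hl hjl e2 - hneg j k hj hk hjk e1 + hpos k l hk hl hkl e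
  by_cases H : ∃ j k l, i ≠ j ∧ i ≠ k ∧ i ≠ l ∧ j ≠ k ∧ j ≠ l ∧ k ≠ l ∧ s j k = -1 ∧ s j l = -1
  · obtain ⟨j, k, l, hj, hk, hl, hjk, hjl, hkl, e1, e2⟩ := H
    left
    have key : ∀ m, i ≠ m → j ≠ m → s j m = -1 := by
      intro m hm hjm
      by_cases hmk : k = m
      · rwa [← hmk]
      by_cases hml : l = m
      · rwa [← hml]
      refine (Int.units_eq_one_or _).resolve_left fun e => ?_
      have f1 : s k m = 1 := (Int.units_eq_one_or _).resolve_right fun f => by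
        have := trans k j m hk hj hm hjk.symm hmk hjm (by rw [hs, e1]) f
        rw [this] at e; exact absurd e (by decide)
      have f2 : s l m = 1 := (Int.units_eq_one_or _).resolve_right fun f => by
        have := trans l j m hl hj hm hjl.symm hml hjm (by rw [hs, e2]) f
        rw [this] at e; exact absurd e (by decide)
      have := hpos k m hk hm hmk f1
      have := hpos l m hl hm hml f2
      have := hneg j k hj hk hjk e1
      have := hneg j l hj hl hjl e2
      exact hg k l hk hl hkl (by simp_all)
    intro k l hk hl hkl
    by_cases hjk : j = k
    · subst hjk; exact key l hl hkl
    by_cases hjl : j = l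
    · subst hjl; rw [hs]; exact key k hk hjk
    exact trans j k l hj hk hl hjk hjl hkl (key k hk hjk) (key l hl hjl)
  · right
    have hm : ∀ j, ∃ m, ∀ k, i ≠ j → i ≠ k → j ≠ k → k ≠ m → s j k = 1 := by
      intro j
      by_cases hj : ∃ k, i ≠ j ∧ i ≠ k ∧ j ≠ k ∧ s j k = -1
      · obtain ⟨m, h1, h3, h4, h5⟩ := hj
        exact ⟨m, fun k e1 e2 e3 e4 => (Int.units_eq_one_or _).resolve_right fun f =>
          H ⟨j, m, k, h1, h3, e2, h4, e3, e4.symm, h5, f⟩⟩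
      · exact ⟨i, fun k e1 e2 e3 e4 => (Int.units_eq_one_or _).resolve_right fun f =>
          hj ⟨k, e1, e2, e3, f⟩⟩
    choose m hm using hm
    obtain ⟨j0, hj0⟩ := Fin.exists_notMem_of_card_lt (s := {i}) (by simp)
    obtain ⟨j1, hj1⟩ := Fin.exists_notMem_of_card_lt (s := {i, j0, m j0})
      (Finset.card_le_three.trans_lt (by norm_num))
    obtain ⟨j2, hj2⟩ := Fin.exists_notMem_of_card_lt (s := {i, j0, m j0, j1, m j1})
      (Finset.card_le_five.trans_lt (by norm_num))
    obtain ⟨j3, hj3⟩ := Fin.exists_notMem_of_card_lt (s := {i, j0, m j0, j1, m j1, j2, m j2})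
      (by
        refine lt_of_le_of_lt (Finset.card_insert_le _ _) ?_
        have := Finset.card_le_six (a := j0) (b := m j0) (c := j1) (d := m j1) (e := j2) (f := m j2)
        omega)
    simp only [Finset.mem_singleton, Finset.mem_insert, not_or] at hj0 hj1 hj2 hj3
    obtain ⟨a1, a2, a3⟩ := hj1
    obtain ⟨b1, b2, b3, b4, b5⟩ := hj2
    obtain ⟨c1, c2, c3, c4, c5, c6, c7⟩ := hj3
    have p01 := hm j0 j1 (Ne.symm hj0) (Ne.symm a1) (Ne.symm a2) a3
    have p02 := hm j0 j2 (Ne.symm hj0) (Ne.symm b1) (Ne.symm b2) b3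
    have p03 := hm j0 j3 (Ne.symm hj0) (Ne.symm c1) (Ne.symm c2) c3
    have p12 := hm j1 j2 (Ne.symm a1) (Ne.symm b1) (Ne.symm b4) b5
    have p13 := hm j1 j3 (Ne.symm a1) (Ne.symm c1) (Ne.symm c4) c5
    have p23 := hm j2 j3 (Ne.symm b1) (Ne.symm c1) (Ne.symm c6) c7
    refine ⟨![j0, j1, j2, j3], ?_, ?_, ?_⟩
    · intro a b
      fin_cases a <;> fin_cases b <;> simp <;> grind
    · intro a; fin_cases a <;> simp <;> grind
    · intro a b; fin_cases a <;> fin_cases b <;> simp <;> grind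

end Signs

section CoreSolutions

open PowerSeries

variable {E : Type*} [Field E] {τ : Fin 8 → E} {α : Fin 8 → Fin 8 → E⟦X⟧} {g : Fin 8 → Fin 8 → E}

/-- The pairs of binary quadratic forms on the lines of a configuration with values at the meeting
points related by the signs `σ`. -/
structure IsSol {A : Type*} [CommRing A] (u : Fin 8 → Fin 8 → Fin 3 → A)
    (σ : Fin 8 → Fin 8 → Fin 8 → Fin 8 → ℤˣ) (a b : Fin 8 → Fin 8 → A) : Prop where
  symm : ∀ i j, i ≠ j → b i j = b j i
  eq : ∀ i j k l, i ≠ j → k ≠ l →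
    evalMeet u a b i j k l = ((σ i j k l : ℤ) : A) * evalMeet u a b k l i j

variable {σ : Fin 8 → Fin 8 → Fin 8 → Fin 8 → ℤˣ} {a b : Fin 8 → Fin 8 → E⟦X⟧}

/-- Four lines of a star with consistent signs and a fifth line form a good clique. -/
theorem SecantData.hasGoodClique_cons (h : SecantData τ α g) (hσ : SignSymm σ) {i k l : Fin 8}
    {j : Fin 4 → Fin 8} (hj : Function.Injective j) (hi : ∀ x, i ≠ j x) (hkl : k ≠ l)
    (e : Fin 4 → ℤˣ) (e0 : ℤˣ) (h1 : ∀ x y, x ≠ y → σ i (j x) i (j y) = e x * e y)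
    (h2 : ∀ x, σ k l i (j x) = e0 * e x)
    (h3 : ∀ x y, x ≠ y → triLines (ends τ α) i (j x) i (j y) k l ≠ 0) :
    HasGoodClique (ends τ α) σ := by
  refine ⟨Fin.cons k fun _ => i, Fin.cons l j, Fin.cons e0 e, ?_, ?_, ?_⟩
  · intro x
    cases x using Fin.cases <;> simp [hkl, hi]
  · intro x y hxy
    cases x using Fin.cases with
    | zero =>
      cases y using Fin.cases with
      | zero => exact absurd rfl hxy
      | succ y => simpa using h2 y
    | succ x =>
      cases y using Fin.cases with
      | zero => simpa [hσ.2 i (j x) k l, mul_comm] using h2 x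
      | succ y => simpa using h1 x y fun e => hxy (by rw [e])
  · intro x y z hxy hxz hyz
    cases x using Fin.cases with
    | zero =>
      cases y using Fin.cases with
      | zero => exact absurd rfl hxy
      | succ y =>
        cases z using Fin.cases with
        | zero => exact absurd rfl hxz
        | succ z =>
          simp only [Fin.cons_zero, Fin.cons_succ]
          rw [← triLines_rotate]
          exact h3 y z fun e => hyz (by rw [e])
    | succ x =>
      cases y using Fin.cases with
      | zero =>
        cases z using Fin.cases with
        | zero => exact absurd rfl hyz
        | succ z =>
          simp only [Fin.cons_zero, Fin.cons_succ]
          rw [triLines_swap, ← triLines_rotate, neg_ne_zero]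
          exact h3 x z fun e => hxz (by rw [e])
      | succ y =>
        cases z using Fin.cases with
        | zero => exact h3 x y fun e => hxy (by rw [e])
        | succ z =>
          have d1 : x ≠ y := fun e => hxy (by rw [e])
          have d2 : x ≠ z := fun e => hxz (by rw [e])
          have d3 : y ≠ z := fun e => hyz (by rw [e])
          exact h.triLines_star (hi x) (hi y) (hi z) (hj.ne d1) (hj.ne d2) (hj.ne d3)

/-- Values on the lines of a star to first order. -/
theorem evalMeet_star (i j k : Fin 8) :
    evalMeet (ends τ α) a b i j i k =
      a i j * tri (ends τ α j i) (ends τ α i k) (ends τ α k i) ^ 2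
      - X * (b i j * tri (ends τ α j i) (ends τ α i k) (ends τ α k i) * ((α i k - α i j) *
          tri ![1, C (τ i), C (τ i) ^ 2] ![0, 1, 2 * C (τ i)] (ends τ α k i)))
      + X ^ 2 * (a j i * ((α i k - α i j) *
          tri ![1, C (τ i), C (τ i) ^ 2] ![0, 1, 2 * C (τ i)] (ends τ α k i)) ^ 2) := by
  simp only [evalMeet, ends, tri_arcPoint_same]
  ring

theorem SecantData.residue_star (h : SecantData τ α g) (hs : IsSol (ends τ α) σ a b)
    {i j k : Fin 8} (hj : i ≠ j) (hk : i ≠ k) (hjk : j ≠ k) :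
    constantCoeff (a i j) = ((σ i j i k : ℤ) : E) * constantCoeff (a i k) := by
  have h1 := congrArg constantCoeff (hs.eq i j i k hj hk)
  simp only [evalMeet_star, map_add, map_sub, map_mul, map_pow, constantCoeff_X, ends,
    constantCoeff_tri_arcPoint, map_intCast] at h1
  have hV : ((τ i - τ j) * (τ k - τ j) * (τ k - τ i)) ^ 2 ≠ 0 := by
    simp [h.sub_ne hj.symm, h.sub_ne hjk, h.sub_ne hk]
  exact mul_right_cancel₀ hV (by linear_combination h1)

theorem SecantData.residue_disjoint (h : SecantData τ α g) (hs : IsSol (ends τ α) σ a b)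
    (ha : ∀ i j, i ≠ j → constantCoeff (a i j) = 0)
    {i j k l : Fin 8} (hij : i ≠ j) (hkl : k ≠ l) (hik : i ≠ k) (hil : i ≠ l) (hjk : j ≠ k)
    (hjl : j ≠ l) :
    constantCoeff (b i j) / (τ j - τ i) ^ 2 =
      ((σ i j k l : ℤ) : E) * (constantCoeff (b k l) / (τ l - τ k) ^ 2) := by
  have h1 := congrArg constantCoeff (hs.eq i j k l hij hkl)
  simp only [evalMeet, map_add, map_sub, map_mul, map_pow, ends,
    constantCoeff_tri_arcPoint, map_intCast, ha i j hij, ha k l hkl, ha j i hij.symm,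
    ha l k hkl.symm] at h1
  have n1 := h.sub_ne hij
  have n2 := h.sub_ne hkl
  have hV : (τ k - τ i) * (τ l - τ i) * (τ k - τ j) * (τ l - τ j) ≠ 0 := by
    simp [h.sub_ne hik, h.sub_ne hil, h.sub_ne hjk, h.sub_ne hjl]
  rw [div_eq_iff (pow_ne_zero 2 n1), mul_assoc, div_mul_eq_mul_div, mul_div_assoc',
    eq_div_iff (pow_ne_zero 2 n2)]
  exact mul_right_cancel₀ hV (by linear_combination -h1)

theorem SecantData.residue_eq_zero (h : SecantData τ α g) (hσ : SignSymm σ)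
    (hc : ¬ HasGoodClique (ends τ α) σ) (hs : IsSol (ends τ α) σ a b) {i j : Fin 8} (hij : i ≠ j) :
    constantCoeff (a i j) = 0 := by
  by_contra h0
  have key : ∀ k, ∃ e : ℤˣ, i ≠ k → constantCoeff (a i k) = ((e : ℤ) : E) * constantCoeff (a i j) := by
    intro k
    by_cases hk : i = k
    · exact ⟨1, fun f => absurd hk f⟩
    by_cases hjk : j = k
    · subst hjk; exact ⟨1, by simp⟩
    · exact ⟨σ i k i j, fun _ => h.residue_star hs hk hij (Ne.symm hjk)⟩
  choose e he using key
  have hσe : ∀ k l, i ≠ k → i ≠ l → k ≠ l → σ i k i l = e k * e l := by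
    intro k l hk hl hkl
    have h1 := h.residue_star hs hk hl hkl
    rw [he k hk, he l hl, ← mul_assoc] at h1
    have h3 : e k = σ i k i l * e l := Int.units_cast_inj h.two h0 (by push_cast; exact h1)
    rw [h3, mul_assoc, Int.units_mul_self, mul_one]
  obtain ⟨j, hj, hi⟩ : ∃ j : Fin 5 → Fin 8, Function.Injective j ∧ ∀ x, i ≠ j x := by
    refine ⟨fun x => i.succAbove (Fin.castLE (by norm_num) x), ?_, ?_⟩
    · exact Fin.succAbove_right_injective.comp (Fin.castLE_injective _)
    · exact fun x => (Fin.succAbove_ne i _).symm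
  refine hc (h.hasGoodClique_cons hσ (i := i) (k := i) (l := j 0) (j := fun x => j x.succ)
    (hj.comp (Fin.succ_injective _)) (fun x => hi _) (hi 0) (fun x => e (j x.succ)) (e (j 0))
    ?_ ?_ ?_)
  · intro x y hxy
    exact hσe _ _ (hi _) (hi _) (hj.ne fun f => hxy (Fin.succ_injective _ f))
  · intro x
    exact hσe _ _ (hi _) (hi _) (hj.ne (Fin.succ_ne_zero x).symm)
  · intro x y hxy
    exact h.triLines_star (hi _) (hi _) (hi _) (hj.ne fun f => hxy (Fin.succ_injective _ f))
      (hj.ne (Fin.succ_ne_zero x)) (hj.ne (Fin.succ_ne_zero y))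

/-- The sign pattern of the bitangents of a quartic: lines sharing an index have sign `-1`. -/
def steinerSign (i j k l : Fin 8) : ℤˣ := if i = k ∨ i = l ∨ j = k ∨ j = l then -1 else 1

/-- A sign pattern differing from `steinerSign` by a coboundary, on pairs of distinct lines. -/
def IsSteiner (σ : Fin 8 → Fin 8 → Fin 8 → Fin 8 → ℤˣ) : Prop :=
  ∃ e : Fin 8 → Fin 8 → ℤˣ, (∀ i j, e i j = e j i) ∧ ∀ i j k l, i ≠ j → k ≠ l →
    ¬(i = k ∧ j = l) → ¬(i = l ∧ j = k) → σ i j k l = e i j * e k l * steinerSign i j k l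

/-- The order one relation between two lines of a star. -/
theorem SecantData.residue_star_one (h : SecantData τ α g) (hs : IsSol (ends τ α) σ a b)
    {a' : Fin 8 → Fin 8 → E⟦X⟧} (ha : ∀ i j, i ≠ j → a i j = X * a' i j) {B : E}
    (hB0 : B ≠ 0) {e : Fin 8 → Fin 8 → ℤˣ}
    (hB : ∀ i j, i ≠ j → constantCoeff (b i j) = ((e i j : ℤ) : E) * B * (τ j - τ i) ^ 2)
    {i j k : Fin 8} (hj : i ≠ j) (hk : i ≠ k) (hjk : j ≠ k) :
    2 * (((e i j : ℤ) : E) * constantCoeff (a' i j) / B) - (g i j + g i k) =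
      ((e i j * σ i j i k * e i k : ℤ) : E) *
        (2 * (((e i k : ℤ) : E) * constantCoeff (a' i k) / B) - (g i j + g i k)) := by
  have h1 := hs.eq i j i k hj hk
  rw [evalMeet_star, evalMeet_star, ha i j hj, ha i k hk, ha j i hj.symm, ha k i hk.symm] at h1
  have h2 := mul_left_cancel₀ (X_ne_zero (R := E)) (a := X) (by
    refine Eq.trans ?_ (h1.trans ?_)
    · exact (show _ = X * (a' i j * tri (ends τ α j i) (ends τ α i k) (ends τ α k i) ^ 2
        - (b i j * tri (ends τ α j i) (ends τ α i k) (ends τ α k i) * ((α i k - α i j) *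
          tri ![1, C (τ i), C (τ i) ^ 2] ![0, 1, 2 * C (τ i)] (ends τ α k i)))
        + X ^ 2 * (a' j i * ((α i k - α i j) *
          tri ![1, C (τ i), C (τ i) ^ 2] ![0, 1, 2 * C (τ i)] (ends τ α k i)) ^ 2)) by ring).symm
    · exact (show _ = X * (((σ i j i k : ℤ) : E⟦X⟧) *
        (a' i k * tri (ends τ α k i) (ends τ α i j) (ends τ α j i) ^ 2
        - (b i k * tri (ends τ α k i) (ends τ α i j) (ends τ α j i) * ((α i j - α i k) *
          tri ![1, C (τ i), C (τ i) ^ 2] ![0, 1, 2 * C (τ i)] (ends τ α j i)))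
        + X ^ 2 * (a' k i * ((α i j - α i k) *
          tri ![1, C (τ i), C (τ i) ^ 2] ![0, 1, 2 * C (τ i)] (ends τ α j i)) ^ 2))) by ring))
  have h3 := congrArg constantCoeff h2
  simp only [map_add, map_sub, map_mul, map_pow, constantCoeff_X, ends,
    constantCoeff_tri_arcPoint, constantCoeff_tri_tangent, map_intCast, hB i j hj, hB i k hk] at h3
  have s1 := h.slope i j k hj hk hjk
  have n1 := h.sub_ne hj
  have n2 := h.sub_ne hk
  have n3 := h.sub_ne hjk
  have q1 := Int.units_mul_cast_self (F := E) (e i j)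
  have q2 := Int.units_mul_cast_self (F := E) (e i k)
  push_cast
  generalize ((e i j : ℤ) : E) = p at *
  generalize ((e i k : ℤ) : E) = q at *
  generalize ((σ i j i k : ℤ) : E) = s at *
  generalize constantCoeff (a' i j) = c at *
  generalize constantCoeff (a' i k) = c' at *
  generalize constantCoeff (α i k) = A at *
  generalize constantCoeff (α i j) = A' at *
  have hV : (τ j - τ i) * (τ k - τ i) * ((τ i - τ j) * (τ k - τ j) * (τ k - τ i)) ^ 2 ≠ 0 := by
    simp [n1, n2, n3, h.sub_ne hj.symm]
  have h4 : 2 * c - p * B * (g i j + g i k) = s * (2 * c' - q * B * (g i j + g i k)) :=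
    mul_left_cancel₀ hV (by
      linear_combination 2 * (τ j - τ i) * (τ k - τ i) * h3 + (p - s * q) * B * (τ j - τ i) ^ 2 *
        (τ k - τ i) ^ 2 * ((τ i - τ j) * (τ k - τ j) * (τ k - τ i)) * s1)
  have h5 : ∀ w, w / B * B = w := fun w => div_mul_cancel₀ w hB0
  refine mul_right_cancel₀ hB0 ?_
  linear_combination 2 * h5 (p * c) - 2 * p * s * q * h5 (q * c') + p * h4
    + (g i j + g i k) * B * q1 - p * s * 2 * c' * q2

theorem SecantData.divisible_or_steiner (h : SecantData τ α g) (hσ : SignSymm σ)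
    (hc : ¬ HasGoodClique (ends τ α) σ) (hs : IsSol (ends τ α) σ a b) :
    (∀ i j, i ≠ j → X ∣ a i j ∧ X ∣ b i j) ∨
      IsSteiner σ ∧ ∀ i j, i ≠ j → constantCoeff (b i j) ≠ 0 := by
  have ha : ∀ i j, i ≠ j → constantCoeff (a i j) = 0 := fun i j => h.residue_eq_zero hσ hc hs
  set β : Fin 8 → Fin 8 → E := fun i j => constantCoeff (b i j) / (τ j - τ i) ^ 2 with hβ
  have hβs : ∀ i j, β i j = β j i := by
    intro i j
    by_cases hij : i = j
    · rw [hij]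
    · simp only [hβ, hs.symm i j hij]
      rw [show (τ j - τ i) ^ 2 = (τ i - τ j) ^ 2 by ring]
  have hβd : ∀ i j k l, i ≠ j → k ≠ l → i ≠ k → i ≠ l → j ≠ k → j ≠ l →
      β i j = ((σ i j k l : ℤ) : E) * β k l :=
    fun i j k l h1 h2 h3 h4 h5 h6 => h.residue_disjoint hs ha h1 h2 h3 h4 h5 h6
  have hβ1 : ∀ i j, i ≠ j → β i j = β 0 1 ∨ β i j = -β 0 1 := by
    intro i j hij
    obtain ⟨m, hm⟩ := Fin.exists_notMem_of_card_lt (s := {i, j, 0, 1})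
      (Finset.card_le_four.trans_lt (by norm_num))
    obtain ⟨n, hn⟩ := Fin.exists_notMem_of_card_lt (s := {i, j, 0, 1, m})
      (Finset.card_le_five.trans_lt (by norm_num))
    simp only [Finset.mem_singleton, Finset.mem_insert, not_or] at hm hn
    have e1 := hβd i j m n hij (Ne.symm hn.2.2.2.2) (Ne.symm hm.1) (Ne.symm hn.1)
      (Ne.symm hm.2.1) (Ne.symm hn.2.1)
    have e2 := hβd m n 0 1 (Ne.symm hn.2.2.2.2) (by decide) hm.2.2.1 hm.2.2.2 hn.2.2.1 hn.2.2.2.1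
    rcases Int.units_eq_one_or (σ i j m n) with f1 | f1 <;>
      rcases Int.units_eq_one_or (σ m n 0 1) with f2 | f2 <;> simp [e1, e2, f1, f2]
  by_cases hB : β 0 1 = 0
  · left
    intro i j hij
    refine ⟨X_dvd_iff.mpr (ha i j hij), X_dvd_iff.mpr ?_⟩
    have h0 : β i j = 0 := by rcases hβ1 i j hij with e | e <;> simp [e, hB]
    rw [hβ] at h0
    exact (div_eq_zero_iff.mp h0).resolve_right (pow_ne_zero 2 (h.sub_ne hij))
  right
  classical
  set e : Fin 8 → Fin 8 → ℤˣ := fun i j => if β i j = β 0 1 then 1 else -1 with he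
  have hes : ∀ i j, e i j = e j i := fun i j => by simp only [he, hβs i j]
  have heβ : ∀ i j, i ≠ j → β i j = ((e i j : ℤ) : E) * β 0 1 := by
    intro i j hij
    by_cases h1 : β i j = β 0 1
    · simp [he, h1]
    · have h2 : e i j = -1 := by simp only [he, if_neg h1]
      rw [h2, (hβ1 i j hij).resolve_left h1]
      simp
  have hbe : ∀ i j, i ≠ j → constantCoeff (b i j) = ((e i j : ℤ) : E) * β 0 1 * (τ j - τ i) ^ 2 := by
    intro i j hij
    rw [← heβ i j hij, hβ, div_mul_cancel₀ _ (pow_ne_zero 2 (h.sub_ne hij))]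
  have hne : ∀ i j, i ≠ j → constantCoeff (b i j) ≠ 0 := by
    intro i j hij
    rw [hbe i j hij]
    refine mul_ne_zero (mul_ne_zero ?_ hB) (pow_ne_zero 2 (h.sub_ne hij))
    intro h0
    have := Int.units_mul_cast_self (F := E) (e i j)
    simp [h0] at this
  have hdis : ∀ i j k l, i ≠ j → k ≠ l → i ≠ k → i ≠ l → j ≠ k → j ≠ l →
      σ i j k l = e i j * e k l := by
    intro i j k l h1 h2 h3 h4 h5 h6
    have e1 := hβd i j k l h1 h2 h3 h4 h5 h6
    rw [heβ i j h1, heβ k l h2, ← mul_assoc] at e1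
    have e2 : e i j = σ i j k l * e k l := Int.units_cast_inj h.two hB (by push_cast; exact e1)
    rw [e2, mul_assoc, Int.units_mul_self, mul_one]
  have hX : ∀ i j, ∃ c, i ≠ j → a i j = X * c := by
    intro i j
    by_cases hij : i = j
    · exact ⟨0, fun f => absurd hij f⟩
    · obtain ⟨c, hc⟩ := X_dvd_iff.mpr (ha i j hij)
      exact ⟨c, fun _ => hc⟩
  choose a' ha' using hX
  have hstar : ∀ i j k, i ≠ j → i ≠ k → j ≠ k → σ i j i k = -(e i j * e i k) := by
    intro i
    have hs1 : ∀ s x y z : ℤˣ, x * s * y = z → s = z * (x * y) := by decide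
    have hsym : ∀ j k, e i j * σ i j i k * e i k = e i k * σ i k i j * e i j := by
      intro j k
      rw [hσ.2 i j i k, mul_right_comm, mul_comm (e i j), mul_right_comm]
    have hpos : ∀ j k, i ≠ j → i ≠ k → j ≠ k → e i j * σ i j i k * e i k = 1 →
        ((e i j : ℤ) : E) * constantCoeff (a' i j) / β 0 1 =
        ((e i k : ℤ) : E) * constantCoeff (a' i k) / β 0 1 := by
      intro j k hj hk hjk h1
      have := h.residue_star_one hs ha' hB hbe hj hk hjk
      have h1' : (e i j * σ i j i k * e i k : ℤ) = 1 := by simpa using congrArg Units.val h1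
      rw [h1'] at this
      refine mul_left_cancel₀ h.two ?_
      push_cast at this
      linear_combination this
    have hneg : ∀ j k, i ≠ j → i ≠ k → j ≠ k → e i j * σ i j i k * e i k = -1 →
        ((e i j : ℤ) : E) * constantCoeff (a' i j) / β 0 1 +
        ((e i k : ℤ) : E) * constantCoeff (a' i k) / β 0 1 = g i j + g i k := by
      intro j k hj hk hjk h1
      have := h.residue_star_one hs ha' hB hbe hj hk hjk
      have h1' : (e i j * σ i j i k * e i k : ℤ) = -1 := by simpa using congrArg Units.val h1
      rw [h1'] at this
      refine mul_left_cancel₀ h.two ?_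
      push_cast at this
      linear_combination this
    rcases star_signs i (g i) (fun j => ((e i j : ℤ) : E) * constantCoeff (a' i j) / β 0 1)
      (fun j k => e i j * σ i j i k * e i k) hsym (h.ne i) hpos hneg with H | ⟨j, hj, hi, H⟩
    · intro j k hj hk hjk
      rw [hs1 _ _ _ _ (H j k hj hk hjk), neg_one_mul]
    · exfalso
      obtain ⟨k, hk⟩ := Fin.exists_notMem_of_card_lt (s := {i, j 0, j 1, j 2, j 3})
        (Finset.card_le_five.trans_lt (by norm_num))
      obtain ⟨l, hl⟩ := Fin.exists_notMem_of_card_lt (s := {i, j 0, j 1, j 2, j 3, k})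
        (Finset.card_le_six.trans_lt (by norm_num))
      simp only [Finset.mem_singleton, Finset.mem_insert, not_or] at hk hl
      have hkl : k ≠ l := Ne.symm hl.2.2.2.2.2
      have hkj : ∀ x, k ≠ j x := by
        intro x; fin_cases x
        exacts [hk.2.1, hk.2.2.1, hk.2.2.2.1, hk.2.2.2.2]
      have hlj : ∀ x, l ≠ j x := by
        intro x; fin_cases x
        exacts [hl.2.1, hl.2.2.1, hl.2.2.2.1, hl.2.2.2.2.1]
      refine hc (h.hasGoodClique_cons hσ hj hi hkl (fun x => e i (j x)) (e k l) ?_ ?_ ?_)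
      · intro x y hxy
        rw [hs1 _ _ _ _ (H x y hxy), one_mul]
      · intro x
        exact hdis _ _ _ _ hkl (hi x) hk.1 (hkj x) hl.1 (hlj x)
      · intro x y hxy
        exact h.triLines_pair (hi x) (hi y) (hj.ne hxy) (Ne.symm hk.1) (Ne.symm hl.1) hkl
  refine ⟨⟨e, hes, ?_⟩, hne⟩
  intro i j k l hij hkl n1 n2
  have hsw : ∀ i j k l, σ i j k l = σ i j l k := fun i j k l => by
    rw [hσ.2, hσ.1, hσ.2]
  have hneg : ∀ x y : ℤˣ, -(x * y) = x * y * -1 := fun x y => by rw [mul_neg_one]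
  by_cases h1 : i = k
  · subst h1
    have : j ≠ l := fun f => n1 ⟨rfl, f⟩
    rw [hstar i j l hij hkl this, hneg]; simp [steinerSign]
  by_cases h2 : i = l
  · subst h2
    have : j ≠ k := fun f => n2 ⟨rfl, f⟩
    rw [hsw, hstar i j k hij (Ne.symm hkl) this, hneg, hes k i]; simp [steinerSign]
  by_cases h3 : j = k
  · subst h3
    rw [hσ.1, hstar j i l (Ne.symm hij) hkl h2, hneg, hes j i]; simp [steinerSign]
  by_cases h4 : j = l
  · subst h4
    rw [hσ.1, hsw, hstar j i k (Ne.symm hij) (Ne.symm hkl) h1, hneg, hes j i, hes k j]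
    simp [steinerSign]
  rw [hdis i j k l hij hkl h1 h2 h3 h4]
  simp [steinerSign, h1, h2, h3, h4]

end CoreSolutions

section LinearSystem

variable {A B : Type*} [CommRing A] [CommRing B]

/-- The left hand sides of the linear system for solutions with sign pattern `σ`, normalised to
vanish on the diagonal, and augmented by a multiple of `b 0 1`. -/
def sysRow (u : Fin 8 → Fin 8 → Fin 3 → A) (σ : Fin 8 → Fin 8 → Fin 8 → Fin 8 → ℤˣ) (c : ℤ)
    (a b : Fin 8 → Fin 8 → A) : Option (Fin 8 × Fin 8 × Fin 8 × Fin 8) → A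
  | none => (c : A) * b 0 1
  | some (i, j, k, l) =>
    if i = j then (if k = l then a k k else b k l - b l k)
    else if k = l then b k k
    else evalMeet u a b i j k l - ((σ i j k l : ℤ) : A) * evalMeet u a b k l i j

/-- The linear system for solutions with sign pattern `σ`. -/
def sysMap (u : Fin 8 → Fin 8 → Fin 3 → A) (σ : Fin 8 → Fin 8 → Fin 8 → Fin 8 → ℤˣ) (c : ℤ) :
    (Bool × Fin 8 × Fin 8 → A) →ₗ[A] (Option (Fin 8 × Fin 8 × Fin 8 × Fin 8) → A) where
  toFun x := sysRow u σ c (fun i j => x (true, i, j)) fun i j => x (false, i, j)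
  map_add' x y := by
    ext (_ | ⟨i, j, k, l⟩)
    · simp [sysRow]; ring
    · simp only [sysRow, evalMeet, Pi.add_apply]
      split_ifs <;> ring
  map_smul' r x := by
    ext (_ | ⟨i, j, k, l⟩)
    · simp [sysRow]; ring
    · simp only [sysRow, evalMeet, Pi.smul_apply, smul_eq_mul, RingHom.id_apply]
      split_ifs <;> ring

theorem map_sysMap (φ : A →+* B) (u : Fin 8 → Fin 8 → Fin 3 → A)
    (σ : Fin 8 → Fin 8 → Fin 8 → Fin 8 → ℤˣ) (c : ℤ) (x : Bool × Fin 8 × Fin 8 → A)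
    (r : Option (Fin 8 × Fin 8 × Fin 8 × Fin 8)) :
    φ (sysMap u σ c x r) = sysMap (fun i j n => φ (u i j n)) σ c (fun q => φ (x q)) r := by
  rcases r with _ | ⟨i, j, k, l⟩
  · simp [sysMap, sysRow]
  · simp only [sysMap, sysRow, LinearMap.coe_mk, AddHom.coe_mk]
    split_ifs <;> simp [map_evalMeet]

variable {u : Fin 8 → Fin 8 → Fin 3 → A} {σ : Fin 8 → Fin 8 → Fin 8 → Fin 8 → ℤˣ} {c : ℤ}

theorem isSol_of_sysMap_eq_zero {x : Bool × Fin 8 × Fin 8 → A} (h : sysMap u σ c x = 0) :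
    IsSol u σ (fun i j => x (true, i, j)) fun i j => x (false, i, j) where
  symm i j hij := by
    have := congrFun h (some (0, 0, i, j))
    simpa [sysMap, sysRow, hij, sub_eq_zero] using this
  eq i j k l hij hkl := by
    have := congrFun h (some (i, j, k, l))
    simpa [sysMap, sysRow, hij, hkl, sub_eq_zero] using this

theorem IsSol.sysMap_eq_zero {a b : Fin 8 → Fin 8 → A} (h : IsSol u σ a b)
    (ha : ∀ i, a i i = 0) (hb : ∀ i, b i i = 0) (hc : (c : A) * b 0 1 = 0) :
    sysMap u σ c (fun q => if q.1 then a q.2.1 q.2.2 else b q.2.1 q.2.2) = 0 := by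
  ext (_ | ⟨i, j, k, l⟩)
  · simpa [sysMap, sysRow] using hc
  · simp only [sysMap, sysRow, LinearMap.coe_mk, AddHom.coe_mk, Pi.zero_apply, if_true,
      Bool.false_eq_true, if_false]
    split_ifs with h1 h2 h2
    · exact ha k
    · exact sub_eq_zero.mpr (h.symm k l h2)
    · exact hb k
    · exact sub_eq_zero.mpr (h.eq i j k l h1 h2)

theorem diag_of_sysMap_eq_zero {x : Bool × Fin 8 × Fin 8 → A} (h : sysMap u σ c x = 0) :
    (∀ i, x (true, i, i) = 0) ∧ ∀ i, x (false, i, i) = 0 := by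
  refine ⟨fun i => ?_, fun i => ?_⟩
  · have := congrFun h (some (0, 0, i, i))
    simpa [sysMap, sysRow] using this
  · have := congrFun h (some (0, 1, i, i))
    simpa [sysMap, sysRow] using this

/-- A left inverse of the linear system, as a family of coefficients. -/
def IsLeftInv (u : Fin 8 → Fin 8 → Fin 3 → A) (σ : Fin 8 → Fin 8 → Fin 8 → Fin 8 → ℤˣ) (c : ℤ)
    (N : Bool × Fin 8 × Fin 8 → Option (Fin 8 × Fin 8 × Fin 8 × Fin 8) → A) : Prop :=
  ∀ p q, ∑ r, N p r * sysMap u σ c (Pi.single q 1) r = if p = q then 1 else 0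

theorem map_single_one {ι : Type*} [DecidableEq ι] (φ : A →+* B) (q : ι) :
    (fun z => φ ((Pi.single q 1 : ι → A) z)) = Pi.single q 1 := by
  ext z
  by_cases hz : z = q
  · subst hz; simp
  · simp [hz]

theorem IsLeftInv.map (φ : A →+* B) {N} (h : IsLeftInv u σ c N) :
    IsLeftInv (fun i j n => φ (u i j n)) σ c (fun p r => φ (N p r)) := by
  intro p q
  have := congrArg φ (h p q)
  simp only [map_sum, map_mul, map_sysMap] at this
  rw [apply_ite φ, map_one, map_zero] at this
  rw [← this]
  simp only [map_single_one]

theorem IsLeftInv.of_map {φ : A →+* B} (hφ : Function.Injective φ) {N}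
    (h : IsLeftInv (fun i j n => φ (u i j n)) σ c (fun p r => φ (N p r))) :
    IsLeftInv u σ c N := by
  intro p q
  apply hφ
  have := h p q
  simp only [map_sum, map_mul, map_sysMap]
  rw [apply_ite φ, map_one, map_zero, ← this]
  simp only [map_single_one]

theorem IsLeftInv.eq_zero {N} (h : IsLeftInv u σ c N) {x : Bool × Fin 8 × Fin 8 → A}
    (hx : sysMap u σ c x = 0) : x = 0 := by
  have h1 : (x : Bool × Fin 8 × Fin 8 → A) = ∑ q, x q • Pi.single q (1 : A) := by
    ext z
    simp [Finset.sum_apply, Pi.single_apply]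
  ext p
  have h2 : ∑ r, N p r * sysMap u σ c x r = x p := by
    calc ∑ r, N p r * sysMap u σ c x r
        = ∑ r, N p r * ∑ q, x q * sysMap u σ c (Pi.single q 1) r := by
          refine Finset.sum_congr rfl fun r _ => ?_
          conv_lhs => rw [h1]
          simp [map_sum, Finset.sum_apply]
      _ = ∑ q, x q * ∑ r, N p r * sysMap u σ c (Pi.single q 1) r := by
          simp only [Finset.mul_sum]
          rw [Finset.sum_comm]
          exact Finset.sum_congr rfl fun q _ => Finset.sum_congr rfl fun r _ => by ring
      _ = x p := by
          simp only [h p]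
          simp
  rw [← h2, hx]
  simp

theorem exists_isLeftInv {K : Type*} [Field K] {u : Fin 8 → Fin 8 → Fin 3 → K}
    (h : ∀ x, sysMap u σ c x = 0 → x = 0) : ∃ N, IsLeftInv u σ c N := by
  obtain ⟨f, hf⟩ := (sysMap u σ c).exists_leftInverse_of_injective
    (LinearMap.ker_eq_bot'.mpr h)
  refine ⟨fun p r => f (Pi.single r 1) p, fun p q => ?_⟩
  have h1 := congrFun (LinearMap.congr_fun hf (Pi.single q 1)) p
  simp only [LinearMap.comp_apply, LinearMap.id_apply] at h1
  have h2 : sysMap u σ c (Pi.single q 1)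
      = ∑ r, sysMap u σ c (Pi.single q 1) r • Pi.single r (1 : K) := by
    ext z
    simp [Finset.sum_apply, Pi.single_apply]
  rw [h2] at h1
  simp only [map_sum, map_smul, Finset.sum_apply, Pi.smul_apply, smul_eq_mul] at h1
  rw [Pi.single_apply] at h1
  rw [← h1]
  exact Finset.sum_congr rfl fun r _ => mul_comm _ _

end LinearSystem

section Generic

open PowerSeries

variable {E : Type*} [Field E] {τ : Fin 8 → E} {α : Fin 8 → Fin 8 → E⟦X⟧} {g : Fin 8 → Fin 8 → E}
  {σ : Fin 8 → Fin 8 → Fin 8 → Fin 8 → ℤˣ}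

theorem SecantData.eq_zero_of_sysMap (h : SecantData τ α g) (hσ : SignSymm σ)
    (hc : ¬ HasGoodClique (ends τ α) σ) {c : ℤ} (hcσ : IsSteiner σ → (c : E) ≠ 0)
    {x : Bool × Fin 8 × Fin 8 → E⟦X⟧} (hx : sysMap (ends τ α) σ c x = 0) : x = 0 := by
  have step : ∀ x : Bool × Fin 8 × Fin 8 → E⟦X⟧, sysMap (ends τ α) σ c x = 0 →
      ∃ y : Bool × Fin 8 × Fin 8 → E⟦X⟧, x = (X : E⟦X⟧) • y ∧ sysMap (ends τ α) σ c y = 0 := by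
    intro x hx
    have hd : ∀ q, X ∣ x q := by
      have h1 : ∀ i j, i ≠ j → X ∣ x (true, i, j) ∧ X ∣ x (false, i, j) := by
        rcases h.divisible_or_steiner hσ hc (isSol_of_sysMap_eq_zero hx) with H | ⟨H, H'⟩
        · exact H
        · exfalso
          have h2 := congrArg constantCoeff (congrFun hx none)
          simp only [sysMap, sysRow, LinearMap.coe_mk, AddHom.coe_mk, map_mul, map_intCast,
            Pi.zero_apply, map_zero] at h2
          exact (mul_ne_zero (hcσ H) (H' 0 1 (by decide))) h2
      rintro ⟨t, i, j⟩
      by_cases hij : i = j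
      · subst hij
        cases t
        · rw [(diag_of_sysMap_eq_zero hx).2]; exact dvd_zero _
        · rw [(diag_of_sysMap_eq_zero hx).1]; exact dvd_zero _
      · cases t
        · exact (h1 i j hij).2
        · exact (h1 i j hij).1
    choose y hy using hd
    have hxy : x = (X : E⟦X⟧) • y := funext hy
    refine ⟨y, hxy, ?_⟩
    rw [hxy, map_smul] at hx
    exact (smul_eq_zero.mp hx).resolve_left X_ne_zero
  have key : ∀ n : ℕ, ∀ x : Bool × Fin 8 × Fin 8 → E⟦X⟧, sysMap (ends τ α) σ c x = 0 →
      ∀ q, X ^ n ∣ x q := by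
    intro n
    induction n with
    | zero => intro x _ q; simp
    | succ n ih =>
      intro x hx q
      obtain ⟨y, rfl, hy⟩ := step x hx
      rw [pow_succ']
      exact mul_dvd_mul_left _ (ih y hy q)
  ext q n
  exact X_pow_dvd_iff.mp (key (n + 1) x hx q) n (Nat.lt_succ_self n)

theorem SecantData.exists_isLeftInv (h : SecantData τ α g) (hσ : SignSymm σ)
    (hc : ¬ HasGoodClique (ends τ α) σ) {c : ℤ} (hcσ : IsSteiner σ → (c : E) ≠ 0) :
    ∃ N, IsLeftInv (fun i j n => algebraMap E⟦X⟧ (FractionRing E⟦X⟧) (ends τ α i j n)) σ c N := by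
  refine _root_.exists_isLeftInv fun x hx => ?_
  obtain ⟨d, hd⟩ := IsLocalization.exist_integer_multiples_of_finite
    (nonZeroDivisors E⟦X⟧) x
  choose y hy using hd
  have hinj := IsFractionRing.injective E⟦X⟧ (FractionRing E⟦X⟧)
  have h1 : sysMap (ends τ α) σ c y = 0 := by
    ext1 r
    apply hinj
    rw [map_sysMap]
    have h2 : (fun q => algebraMap E⟦X⟧ (FractionRing E⟦X⟧) (y q))
        = algebraMap E⟦X⟧ (FractionRing E⟦X⟧) (d : E⟦X⟧) • x := by
      ext q
      rw [hy, Pi.smul_apply, Algebra.smul_def, smul_eq_mul]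
    rw [h2, map_smul, hx]
    simp
  have h3 := h.eq_zero_of_sysMap hσ hc hcσ h1
  ext q
  have h4 := hy q
  rw [h3] at h4
  simp only [Pi.zero_apply, map_zero] at h4
  rw [Algebra.smul_def] at h4
  exact (mul_eq_zero.mp h4.symm).resolve_left
    ((map_ne_zero_iff _ hinj).mpr (nonZeroDivisors.ne_zero d.2))

end Generic

section Quartics

variable {A B : Type*} [CommRing A] [CommRing B]

/-- The monomials of degree four in three variables, as sorted products of variables. -/
def quarticIdx : Fin 15 → Fin 4 → Fin 3 :=
  ![![0, 0, 0, 0], ![0, 0, 0, 1], ![0, 0, 0, 2], ![0, 0, 1, 1], ![0, 0, 1, 2], ![0, 0, 2, 2],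
    ![0, 1, 1, 1], ![0, 1, 1, 2], ![0, 1, 2, 2], ![0, 2, 2, 2], ![1, 1, 1, 1], ![1, 1, 1, 2],
    ![1, 1, 2, 2], ![1, 2, 2, 2], ![2, 2, 2, 2]]

/-- The value at `u` of the quartic with coefficients `c`. -/
def quartic (c : Fin 15 → A) (u : Fin 3 → A) : A :=
  ∑ n, c n * (u (quarticIdx n 0) * u (quarticIdx n 1) * u (quarticIdx n 2) * u (quarticIdx n 3))

/-- The coefficient of `s³ t` in the quartic at `s u + t v`. -/
def quarticPolar₁ (c : Fin 15 → A) (u v : Fin 3 → A) : A :=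
  ∑ n, c n * (v (quarticIdx n 0) * u (quarticIdx n 1) * u (quarticIdx n 2) * u (quarticIdx n 3)
    + u (quarticIdx n 0) * v (quarticIdx n 1) * u (quarticIdx n 2) * u (quarticIdx n 3)
    + u (quarticIdx n 0) * u (quarticIdx n 1) * v (quarticIdx n 2) * u (quarticIdx n 3)
    + u (quarticIdx n 0) * u (quarticIdx n 1) * u (quarticIdx n 2) * v (quarticIdx n 3))

/-- The coefficient of `s² t²` in the quartic at `s u + t v`. -/
def quarticPolar₂ (c : Fin 15 → A) (u v : Fin 3 → A) : A :=
  ∑ n, c n * (v (quarticIdx n 0) * v (quarticIdx n 1) * u (quarticIdx n 2) * u (quarticIdx n 3)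
    + v (quarticIdx n 0) * u (quarticIdx n 1) * v (quarticIdx n 2) * u (quarticIdx n 3)
    + v (quarticIdx n 0) * u (quarticIdx n 1) * u (quarticIdx n 2) * v (quarticIdx n 3)
    + u (quarticIdx n 0) * v (quarticIdx n 1) * v (quarticIdx n 2) * u (quarticIdx n 3)
    + u (quarticIdx n 0) * v (quarticIdx n 1) * u (quarticIdx n 2) * v (quarticIdx n 3)
    + u (quarticIdx n 0) * u (quarticIdx n 1) * v (quarticIdx n 2) * v (quarticIdx n 3))

theorem quartic_line (c : Fin 15 → A) (u v : Fin 3 → A) (s t : A) :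
    quartic c (fun i => s * u i + t * v i) =
      quartic c u * s ^ 4 + quarticPolar₁ c u v * s ^ 3 * t + quarticPolar₂ c u v * s ^ 2 * t ^ 2
        + quarticPolar₁ c v u * s * t ^ 3 + quartic c v * t ^ 4 := by
  simp only [quartic, quarticPolar₁, quarticPolar₂, Finset.sum_mul, ← Finset.sum_add_distrib]
  refine Finset.sum_congr rfl fun n _ => ?_
  ring

theorem map_quartic (φ : A →+* B) (c : Fin 15 → A) (u : Fin 3 → A) :
    φ (quartic c u) = quartic (fun n => φ (c n)) fun i => φ (u i) := by
  simp [quartic]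

theorem map_quarticPolar₁ (φ : A →+* B) (c : Fin 15 → A) (u v : Fin 3 → A) :
    φ (quarticPolar₁ c u v) = quarticPolar₁ (fun n => φ (c n)) (fun i => φ (u i))
      fun i => φ (v i) := by
  simp [quarticPolar₁]

theorem map_quarticPolar₂ (φ : A →+* B) (c : Fin 15 → A) (u v : Fin 3 → A) :
    φ (quarticPolar₂ c u v) = quarticPolar₂ (fun n => φ (c n)) (fun i => φ (u i))
      fun i => φ (v i) := by
  simp [quarticPolar₂]

/-- The quartic with coefficients `c` restricts to a square on the line through `u` and `v`. -/
structure IsSquareOn (c : Fin 15 → A) (u v : Fin 3 → A) (p q r : A) : Prop where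
  c0 : quartic c u = p ^ 2
  c1 : quarticPolar₁ c u v = 2 * p * q
  c2 : quarticPolar₂ c u v = 2 * p * r + q ^ 2
  c3 : quarticPolar₁ c v u = 2 * r * q
  c4 : quartic c v = r ^ 2

theorem IsSquareOn.map (φ : A →+* B) {c : Fin 15 → A} {u v : Fin 3 → A} {p q r : A}
    (h : IsSquareOn c u v p q r) :
    IsSquareOn (fun n => φ (c n)) (fun i => φ (u i)) (fun i => φ (v i)) (φ p) (φ q) (φ r) where
  c0 := by rw [← map_quartic, h.c0, map_pow]
  c1 := by rw [← map_quarticPolar₁, h.c1]; simp [map_ofNat]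
  c2 := by rw [← map_quarticPolar₂, h.c2]; simp [map_ofNat]
  c3 := by rw [← map_quarticPolar₁, h.c3]; simp [map_ofNat]
  c4 := by rw [← map_quartic, h.c4, map_pow]

theorem IsSquareOn.symm {c : Fin 15 → A} {u v : Fin 3 → A} {p q r : A}
    (h : IsSquareOn c u v p q r) : IsSquareOn c v u r q p where
  c0 := h.c4
  c1 := h.c3
  c2 := by
    have : quarticPolar₂ c v u = quarticPolar₂ c u v :=
      Finset.sum_congr rfl fun n _ => by ring
    rw [this, h.c2]; ring
  c3 := h.c1
  c4 := h.c0

theorem IsSquareOn.eq {c : Fin 15 → A} {u v : Fin 3 → A} {p q r : A}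
    (h : IsSquareOn c u v p q r) (s t : A) :
    quartic c (fun i => s * u i + t * v i) = (p * s ^ 2 + q * s * t + r * t ^ 2) ^ 2 := by
  rw [quartic_line, h.c0, h.c1, h.c2, h.c3, h.c4]; ring

/-- The coefficients of `(x z - y²)²`. -/
def conicSqCoeff : Fin 15 → ℤ := ![0, 0, 0, 0, 0, 1, 0, -2, 0, 0, 1, 0, 0, 0, 0]

/-- The coefficients of `(z - x) (z - 4 x) (z - 9 x) (z - 16 x)`. -/
def pencilCoeff : Fin 15 → ℤ := ![576, 0, -820, 0, 0, 273, 0, 0, 0, -30, 0, 0, 0, 0, 1]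

/-- The quartic `(x z - y²)² + ε (z - x) (z - 4 x) (z - 9 x) (z - 16 x) + ε² m`. -/
def degenCoeff (ε : A) (m : Fin 15 → A) (n : Fin 15) : A :=
  (conicSqCoeff n : A) + ε * ((pencilCoeff n : A) + ε * m n)

theorem quartic_degen (ε : A) (m : Fin 15 → A) (u : Fin 3 → A) :
    quartic (degenCoeff ε m) u = quartic (fun n => (conicSqCoeff n : A)) u
      + ε * (quartic (fun n => (pencilCoeff n : A)) u + ε * quartic m u) := by
  simp only [quartic, degenCoeff, Finset.mul_sum, ← Finset.sum_add_distrib]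
  exact Finset.sum_congr rfl fun n _ => by ring

theorem quarticPolar₁_degen (ε : A) (m : Fin 15 → A) (u v : Fin 3 → A) :
    quarticPolar₁ (degenCoeff ε m) u v = quarticPolar₁ (fun n => (conicSqCoeff n : A)) u v
      + ε * quarticPolar₁ (fun n => (pencilCoeff n : A) + ε * m n) u v := by
  simp only [quarticPolar₁, degenCoeff, Finset.mul_sum, ← Finset.sum_add_distrib]
  exact Finset.sum_congr rfl fun n _ => by ring

theorem quarticPolar₂_degen (ε : A) (m : Fin 15 → A) (u v : Fin 3 → A) :
    quarticPolar₂ (degenCoeff ε m) u v = quarticPolar₂ (fun n => (conicSqCoeff n : A)) u v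
      + ε * quarticPolar₂ (fun n => (pencilCoeff n : A) + ε * m n) u v := by
  simp only [quarticPolar₂, degenCoeff, Finset.mul_sum, ← Finset.sum_add_distrib]
  exact Finset.sum_congr rfl fun n _ => by ring

theorem isSquareOn_conicSq (u v : Fin 3 → A) :
    IsSquareOn (fun n => (conicSqCoeff n : A)) u v (u 0 * u 2 - u 1 ^ 2)
      (u 0 * v 2 + u 2 * v 0 - 2 * u 1 * v 1) (v 0 * v 2 - v 1 ^ 2) := by
  constructor <;> simp [quartic, quarticPolar₁, quarticPolar₂, Fin.sum_univ_succ, conicSqCoeff,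
    quarticIdx] <;> ring

theorem quartic_pencil (t y : A) :
    quartic (fun n => (pencilCoeff n : A)) ![1, t + y, t ^ 2 + 2 * t * y] =
      ((t ^ 2) ^ 4 - 30 * (t ^ 2) ^ 3 + 273 * (t ^ 2) ^ 2 - 820 * t ^ 2 + 576)
      + (4 * (t ^ 2) ^ 3 - 90 * (t ^ 2) ^ 2 + 546 * t ^ 2 - 820) * (2 * t * y)
      + (6 * (t ^ 2) ^ 2 - 90 * t ^ 2 + 273) * (2 * t * y) ^ 2
      + (4 * t ^ 2 - 30) * (2 * t * y) ^ 3 + (2 * t * y) ^ 4 := by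
  simp [quartic, Fin.sum_univ_succ, pencilCoeff, quarticIdx]
  ring

theorem quarticPolar₁_pencil (t s : A) :
    quarticPolar₁ (fun n => (pencilCoeff n : A)) ![1, t, t ^ 2] ![1, s, s ^ 2] =
      4 * ((t ^ 2) ^ 4 - 30 * (t ^ 2) ^ 3 + 273 * (t ^ 2) ^ 2 - 820 * t ^ 2 + 576)
      + (4 * (t ^ 2) ^ 3 - 90 * (t ^ 2) ^ 2 + 546 * t ^ 2 - 820) * (s ^ 2 - t ^ 2) := by
  simp [quarticPolar₁, Fin.sum_univ_succ, pencilCoeff, quarticIdx]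
  ring

end Quartics

/-- A contraction for the `X`-adic topology has a fixed point. -/
theorem PowerSeries.exists_fixedPoint {ι k : Type*} [CommRing k]
    (T : (ι → PowerSeries k) → ι → PowerSeries k)
    (hT : ∀ n x y, (∀ i, (PowerSeries.X : PowerSeries k) ^ n ∣ x i - y i) →
      ∀ i, (PowerSeries.X : PowerSeries k) ^ (n + 1) ∣ T x i - T y i) :
    ∃ x, T x = x := by
  have h1 : ∀ n i, (PowerSeries.X : PowerSeries k) ^ n ∣ T^[n + 1] 0 i - T^[n] 0 i := by
    intro n
    induction n with
    | zero => simp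
    | succ n ih =>
      rw [Function.iterate_succ_apply', Function.iterate_succ_apply' T n]
      exact hT n _ _ fun i => by simpa only [Function.iterate_succ_apply'] using ih i
  have h2 : ∀ n d i, (PowerSeries.X : PowerSeries k) ^ n ∣ T^[n + d] 0 i - T^[n] 0 i := by
    intro n d i
    induction d with
    | zero => simp
    | succ d ih =>
      have := (pow_dvd_pow _ (Nat.le_add_right n d)).trans (h1 (n + d) i)
      simpa [add_assoc] using dvd_add this ih
  let x : ι → PowerSeries k := fun i => PowerSeries.mk fun n => coeff n (T^[n + 1] 0 i)
  have hx : ∀ n i, (PowerSeries.X : PowerSeries k) ^ n ∣ x i - T^[n] 0 i := by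
    intro n i
    rw [PowerSeries.X_pow_dvd_iff]
    intro j hj
    obtain ⟨d, rfl⟩ := Nat.exists_eq_add_of_lt hj
    have := PowerSeries.X_pow_dvd_iff.1 (h2 (j + 1) d i) j (Nat.lt_succ_self j)
    rw [map_sub, sub_eq_zero, show j + 1 + d = j + d + 1 by ring] at this
    simp only [x, map_sub, PowerSeries.coeff_mk, sub_eq_zero]
    exact this.symm
  refine ⟨x, funext fun i => ?_⟩
  rw [← sub_eq_zero]
  ext n
  have h3 := hT n _ _ (hx n) i
  rw [← Function.iterate_succ_apply' T] at h3
  have h4 := dvd_sub h3 (hx (n + 1) i)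
  rw [sub_sub_sub_cancel_right] at h4
  simpa using PowerSeries.X_pow_dvd_iff.1 h4 n (Nat.lt_succ_self n)

section Newton

variable {A B : Type*} [CommRing A] [CommRing B]

/-- A point infinitely near to the point `(1, t, t²)` of the conic, on the tangent there. -/
def tangentPoint (t y : A) : Fin 3 → A := ![1, t + y, t ^ 2 + 2 * t * y]

theorem map_tangentPoint (φ : A →+* B) (t y : A) :
    (fun i => φ (tangentPoint t y i)) = tangentPoint (φ t) (φ y) := by
  funext i
  fin_cases i <;> simp [tangentPoint, map_ofNat]

/-- The Newton iteration for the perturbation of the first coefficient of the square root.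
The last four arguments stand for products of unknowns with the deformation parameter. -/
def newtonEnd (κ : Fin 15 → A) (t s c y z αs₁ αs₀ βs₀ s₀s₁ : A) : A :=
  c * (quarticPolar₁ κ (tangentPoint t y) (tangentPoint s z) + 2 * y * αs₁
    - 4 * (s - t) * (βs₀ - αs₀) + 4 * y * βs₀ - 2 * s₀s₁)

/-- The Newton iteration for the perturbation of the middle coefficient of the square root. -/
def newtonMid (κ : Fin 15 → A) (t s c y z αs₂ αs₁ βs₁ βs₀ s₀s₂ s₁s₁ : A) : A :=
  c * (quarticPolar₂ κ (tangentPoint t y) (tangentPoint s z) + 2 * y * αs₂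
    - 4 * (s - t) * (βs₁ - αs₁) + 4 * y * βs₁ + 2 * z * βs₀ - 2 * s₀s₂ - s₁s₁)

/-- The Newton iteration for the displacement of the point. -/
def newtonPoint (m : Fin 15 → A) (t a y σ αα ααs₀ : A) : A :=
  a * (σ ^ 2 - quartic m (tangentPoint t y)
    - (αα * (4 * t ^ 2 * (6 * t ^ 4 - 90 * t ^ 2 + 273 + (4 * t ^ 2 - 30) * (2 * t * y)
      + 4 * t ^ 2 * y ^ 2)) + 2 * ααs₀))

theorem map_newtonEnd (φ : A →+* B) (κ : Fin 15 → A) (t s c y z αs₁ αs₀ βs₀ s₀s₁ : A) :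
    φ (newtonEnd κ t s c y z αs₁ αs₀ βs₀ s₀s₁) = newtonEnd (fun n => φ (κ n)) (φ t) (φ s) (φ c)
      (φ y) (φ z) (φ αs₁) (φ αs₀) (φ βs₀) (φ s₀s₁) := by
  simp [newtonEnd, map_quarticPolar₁, map_tangentPoint, map_ofNat]

theorem map_newtonMid (φ : A →+* B) (κ : Fin 15 → A)
    (t s c y z αs₂ αs₁ βs₁ βs₀ s₀s₂ s₁s₁ : A) :
    φ (newtonMid κ t s c y z αs₂ αs₁ βs₁ βs₀ s₀s₂ s₁s₁) = newtonMid (fun n => φ (κ n)) (φ t) (φ s)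
      (φ c) (φ y) (φ z) (φ αs₂) (φ αs₁) (φ βs₁) (φ βs₀) (φ s₀s₂) (φ s₁s₁) := by
  simp [newtonMid, map_quarticPolar₂, map_tangentPoint, map_ofNat]

theorem map_newtonPoint (φ : A →+* B) (m : Fin 15 → A) (t a y σ αα ααs₀ : A) :
    φ (newtonPoint m t a y σ αα ααs₀) = newtonPoint (fun n => φ (m n)) (φ t) (φ a) (φ y) (φ σ)
      (φ αα) (φ ααs₀) := by
  simp [newtonPoint, map_quartic, map_tangentPoint, map_ofNat]

/-- The quartic polynomial `(z - 1) (z - 4) (z - 9) (z - 16)` at `z = t²`. -/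
def pencilPoly (t : A) : A := (t ^ 2) ^ 4 - 30 * (t ^ 2) ^ 3 + 273 * (t ^ 2) ^ 2 - 820 * t ^ 2 + 576

/-- The derivative of `(z - 1) (z - 4) (z - 9) (z - 16)` at `z = t²`. -/
def pencilDeriv (t : A) : A := 4 * (t ^ 2) ^ 3 - 90 * (t ^ 2) ^ 2 + 546 * t ^ 2 - 820

theorem map_pencilPoly (φ : A →+* B) (t : A) : φ (pencilPoly t) = pencilPoly (φ t) := by
  simp [pencilPoly, map_ofNat]

theorem map_pencilDeriv (φ : A →+* B) (t : A) : φ (pencilDeriv t) = pencilDeriv (φ t) := by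
  simp [pencilDeriv, map_ofNat]

theorem quartic_degen_tangentPoint (ε : A) (m : Fin 15 → A) {t a α σ : A}
    (ht : pencilPoly t = 0) (ha : a * (2 * t * pencilDeriv t) = 1)
    (h : newtonPoint m t a (ε * α) σ (ε * (α * α)) (ε * (α * α * σ)) = α) :
    quartic (degenCoeff ε m) (tangentPoint t (ε * α)) = (-(ε * α) ^ 2 + ε * σ) ^ 2 := by
  have hm : σ ^ 2 - quartic m (tangentPoint t (ε * α))
      - (ε * (α * α) * (4 * t ^ 2 * (6 * t ^ 4 - 90 * t ^ 2 + 273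
        + (4 * t ^ 2 - 30) * (2 * t * (ε * α)) + 4 * t ^ 2 * (ε * α) ^ 2))
        + 2 * (ε * (α * α * σ))) = α * (2 * t * pencilDeriv t) := by
    rw [newtonPoint] at h
    linear_combination (2 * t * pencilDeriv t) * h - (σ ^ 2 - quartic m (tangentPoint t (ε * α))
      - (ε * (α * α) * (4 * t ^ 2 * (6 * t ^ 4 - 90 * t ^ 2 + 273
        + (4 * t ^ 2 - 30) * (2 * t * (ε * α)) + 4 * t ^ 2 * (ε * α) ^ 2))
        + 2 * (ε * (α * α * σ)))) * ha
  have hp := quartic_pencil t (ε * α)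
  rw [pencilPoly] at ht
  rw [pencilDeriv] at hm
  rw [quartic_degen, (isSquareOn_conicSq _ (tangentPoint t (ε * α))).c0]
  rw [← tangentPoint] at hp
  rw [hp]
  simp only [tangentPoint, Matrix.cons_val] at hm ⊢
  linear_combination (-ε ^ 2) * hm + ε * ht

/-- The middle coefficient of the conic on the line through two tangent points. -/
def conicMid (t s y z : A) : A := (s - t) ^ 2 + 2 * (s - t) * (z - y) - 2 * y * z

theorem quarticPolar₁_degen_tangentPoint (ε : A) (m : Fin 15 → A) {t s c α β s₀ s₁ : A}
    (hc : c * (2 * (s - t) ^ 2) = 1)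
    (h : newtonEnd (fun n => (pencilCoeff n : A) + ε * m n) t s c (ε * α) (ε * β) (ε * (α * s₁))
      (ε * (α * s₀)) (ε * (β * s₀)) (ε * (s₀ * s₁)) = s₀) :
    quarticPolar₁ (degenCoeff ε m) (tangentPoint t (ε * α)) (tangentPoint s (ε * β)) =
      2 * (-(ε * α) ^ 2 + ε * s₀) * (conicMid t s (ε * α) (ε * β) + ε * s₁) := by
  rw [quarticPolar₁_degen, (isSquareOn_conicSq _ _).c1]
  rw [newtonEnd] at h
  generalize quarticPolar₁ (fun n => (pencilCoeff n : A) + ε * m n) _ _ = P at h ⊢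
  simp only [tangentPoint, Matrix.cons_val, conicMid]
  linear_combination (ε * (2 * (s - t) ^ 2)) * h - ε * (P + 2 * (ε * α) * (ε * (α * s₁))
    - 4 * (s - t) * (ε * (β * s₀) - ε * (α * s₀)) + 4 * (ε * α) * (ε * (β * s₀))
    - 2 * (ε * (s₀ * s₁))) * hc

theorem quarticPolar₂_degen_tangentPoint (ε : A) (m : Fin 15 → A) {t s c α β s₀ s₁ s₂ : A}
    (hc : c * (2 * (s - t) ^ 2) = 1)
    (h : newtonMid (fun n => (pencilCoeff n : A) + ε * m n) t s c (ε * α) (ε * β) (ε * (α * s₂))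
      (ε * (α * s₁)) (ε * (β * s₁)) (ε * (β * s₀)) (ε * (s₀ * s₂)) (ε * (s₁ * s₁)) = s₁) :
    quarticPolar₂ (degenCoeff ε m) (tangentPoint t (ε * α)) (tangentPoint s (ε * β)) =
      2 * (-(ε * α) ^ 2 + ε * s₀) * (-(ε * β) ^ 2 + ε * s₂)
        + (conicMid t s (ε * α) (ε * β) + ε * s₁) ^ 2 := by
  rw [quarticPolar₂_degen, (isSquareOn_conicSq _ _).c2]
  rw [newtonMid] at h
  generalize quarticPolar₂ (fun n => (pencilCoeff n : A) + ε * m n) _ _ = P at h ⊢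
  simp only [tangentPoint, Matrix.cons_val, conicMid]
  linear_combination (ε * (2 * (s - t) ^ 2)) * h - ε * (P + 2 * (ε * α) * (ε * (α * s₂))
    - 4 * (s - t) * (ε * (β * s₁) - ε * (α * s₁)) + 4 * (ε * α) * (ε * (β * s₁))
    + 2 * (ε * β) * (ε * (β * s₀)) - 2 * (ε * (s₀ * s₂)) - ε * (s₁ * s₁)) * hc

end Newton

open PowerSeries in
/-- Infinitely near bitangents of the degeneration of a double conic. -/
theorem exists_bitangent_degen {E : Type*} [Field E] (h2 : (2 : E) ≠ 0) (m : Fin 15 → PowerSeries E)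
    {t s : E} (ht0 : t ≠ 0) (hs0 : s ≠ 0) (hts : t ≠ s) (ht : pencilPoly t = 0)
    (hs : pencilPoly s = 0) (ht' : pencilDeriv t ≠ 0) (hs' : pencilDeriv s ≠ 0) :
    ∃ α β p q r : PowerSeries E,
      IsSquareOn (degenCoeff X m) (arcPoint t α) (arcPoint s β) p q r ∧
      constantCoeff α * (2 * t * pencilDeriv t)
        + quartic (fun n => constantCoeff (m n)) ![1, t, t ^ 2]
          = (pencilDeriv t * (t + s) / (2 * (s - t))) ^ 2 ∧
      constantCoeff β * (2 * s * pencilDeriv s)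
        + quartic (fun n => constantCoeff (m n)) ![1, s, s ^ 2]
          = (pencilDeriv s * (s + t) / (2 * (t - s))) ^ 2 := by
  have hx : s - t ≠ 0 := sub_ne_zero.2 hts.symm
  have hx' : t - s ≠ 0 := sub_ne_zero.2 hts
  let c : PowerSeries E := C (2 * (s - t) ^ 2)⁻¹
  let a : PowerSeries E := C (2 * t * pencilDeriv t)⁻¹
  let b : PowerSeries E := C (2 * s * pencilDeriv s)⁻¹
  have hc : c * (2 * (C s - C t) ^ 2) = 1 := by
    have : (2 * (C s - C t) ^ 2 : PowerSeries E) = C (2 * (s - t) ^ 2) := by simp [map_ofNat]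
    rw [this, ← map_mul, inv_mul_cancel₀ (mul_ne_zero h2 (pow_ne_zero 2 hx)), map_one]
  have hxi : ∀ {t : E}, t ≠ 0 → pencilDeriv t ≠ 0 →
      C (2 * t * pencilDeriv t)⁻¹ * (2 * C t * pencilDeriv (C t)) = (1 : PowerSeries E) := by
    intro t ht ht'
    have : (2 * C t * pencilDeriv (C t) : PowerSeries E) = C (2 * t * pencilDeriv t) := by
      simp [map_ofNat, map_pencilDeriv]
    rw [this, ← map_mul, inv_mul_cancel₀ (mul_ne_zero (mul_ne_zero h2 ht) ht'), map_one]
  have ha : a * (2 * C t * pencilDeriv (C t)) = 1 := hxi ht0 ht'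
  have hb : b * (2 * C s * pencilDeriv (C s)) = 1 := hxi hs0 hs'
  clear_value a b c
  let κ : Fin 15 → PowerSeries E := fun n => (pencilCoeff n : PowerSeries E) + X * m n
  let T : (Fin 5 → PowerSeries E) → Fin 5 → PowerSeries E := fun x =>
    let σ₀ := newtonEnd κ (C t) (C s) c (X * x 0) (X * x 1) (X * (x 0 * x 3)) (X * (x 0 * x 2))
      (X * (x 1 * x 2)) (X * (x 2 * x 3))
    let σ₂ := newtonEnd κ (C s) (C t) c (X * x 1) (X * x 0) (X * (x 1 * x 3)) (X * (x 1 * x 4))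
      (X * (x 0 * x 4)) (X * (x 4 * x 3))
    ![newtonPoint m (C t) a (X * x 0) σ₀ (X * (x 0 * x 0)) (X * (x 0 * x 0 * x 2)),
      newtonPoint m (C s) b (X * x 1) σ₂ (X * (x 1 * x 1)) (X * (x 1 * x 1 * x 4)),
      σ₀,
      newtonMid κ (C t) (C s) c (X * x 0) (X * x 1) (X * (x 0 * x 4)) (X * (x 0 * x 3))
        (X * (x 1 * x 3)) (X * (x 1 * x 2)) (X * (x 2 * x 4)) (X * (x 3 * x 3)),
      σ₂]
  obtain ⟨x, hxT⟩ : ∃ x, T x = x := by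
    refine PowerSeries.exists_fixedPoint T fun n x y h i => ?_
    let I : Ideal (PowerSeries E) := Ideal.span {X ^ (n + 1)}
    have hI : ∀ w z : PowerSeries E, Ideal.Quotient.mk I w = Ideal.Quotient.mk I z ↔
        X ^ (n + 1) ∣ w - z := fun w z => by
      rw [Ideal.Quotient.eq, Ideal.mem_span_singleton]
    have e1 : ∀ i, Ideal.Quotient.mk I (X * x i) = Ideal.Quotient.mk I (X * y i) := fun i => by
      rw [hI, ← mul_sub, pow_succ']
      exact mul_dvd_mul_left _ (h i)
    have e2 : ∀ i j, Ideal.Quotient.mk I (X * (x i * x j)) =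
        Ideal.Quotient.mk I (X * (y i * y j)) := fun i j => by
      rw [hI, ← mul_sub, pow_succ']
      refine mul_dvd_mul_left _ ?_
      rw [show x i * x j - y i * y j = (x i - y i) * x j + y i * (x j - y j) by ring]
      exact dvd_add ((h i).mul_right _) ((h j).mul_left _)
    have e3 : ∀ i j, Ideal.Quotient.mk I (X * (x i * x i * x j)) =
        Ideal.Quotient.mk I (X * (y i * y i * y j)) := fun i j => by
      rw [hI, ← mul_sub, pow_succ']
      refine mul_dvd_mul_left _ ?_
      rw [show x i * x i * x j - y i * y i * y j =
        (x i - y i) * (x i * x j + y i * x j) + y i * y i * (x j - y j) by ring]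
      exact dvd_add ((h i).mul_right _) ((h j).mul_left _)
    rw [← hI]
    fin_cases i <;>
      simp [T, map_newtonEnd, map_newtonMid, map_newtonPoint, e1, e2, e3, -map_mul]
  have h0 := congrFun hxT 0
  have h1 := congrFun hxT 1
  have h2' := congrFun hxT 2
  have h3 := congrFun hxT 3
  have h4 := congrFun hxT 4
  simp [T] at h2' h3 h4
  simp [T, h2', h4] at h0 h1
  have hc' : c * (2 * (C t - C s) ^ 2) = 1 := by rw [← hc]; ring
  have hsymm : conicMid (C s) (C t) (X * x 1) (X * x 0) =
      conicMid (C t) (C s) (X * x 0) (X * x 1) := by simp only [conicMid]; ring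
  have hroot : ∀ {t : E}, pencilPoly t = 0 → pencilPoly (C t : PowerSeries E) = 0 := fun h => by
    rw [← map_pencilPoly, h, map_zero]
  have tp : ∀ (t : E) α, arcPoint t α = tangentPoint (C t) (X * α) := fun t α => by
    rfl
  have hP : ∀ {t s : E}, t ≠ s → pencilPoly t = 0 → ∀ {a c α y σ αα ααs β αs₁ αs₀ βs₀ s₀s₁},
      a * (2 * C t * pencilDeriv (C t)) = 1 → c * (2 * (C s - C t) ^ 2) = 1 →
      newtonPoint m (C t) a (X * y) σ (X * αα) (X * ααs) = α →
      newtonEnd κ (C t) (C s) c (X * y) (X * β) (X * αs₁) (X * αs₀) (X * βs₀) (X * s₀s₁) = σ →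
      constantCoeff α * (2 * t * pencilDeriv t)
        + quartic (fun n => constantCoeff (m n)) ![1, t, t ^ 2]
          = (pencilDeriv t * (t + s) / (2 * (s - t))) ^ 2 := by
    intro t s hts ht a c α y σ αα ααs β αs₁ αs₀ βs₀ s₀s₁ ha hc h1 h2
    have hx : s - t ≠ 0 := sub_ne_zero.2 hts.symm
    have e0 : ∀ (t : E), tangentPoint t 0 = ![1, t, t ^ 2] := fun t => by simp [tangentPoint]
    replace ha := congrArg constantCoeff ha
    replace hc := congrArg constantCoeff hc
    replace h1 := congrArg constantCoeff h1
    replace h2 := congrArg constantCoeff h2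
    rw [map_newtonPoint] at h1
    rw [map_newtonEnd] at h2
    simp [map_ofNat, κ, map_pencilDeriv] at ha hc h1 h2
    have h3 := quarticPolar₁_pencil t s
    rw [← pencilPoly, ← pencilDeriv, ht] at h3
    simp only [newtonPoint, newtonEnd, e0] at h1 h2
    rw [h3] at h2
    have h4 : constantCoeff σ = pencilDeriv t * (t + s) / (2 * (s - t)) := by
      rw [← h2]
      field_simp
      linear_combination (pencilDeriv t * (t + s)) * hc
    rw [← h4]
    rw [← h1]
    linear_combination (constantCoeff σ ^ 2 - quartic (fun n => constantCoeff (m n)) ![1, t, t ^ 2]) * ha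
  refine ⟨x 0, x 1, -(X * x 0) ^ 2 + X * x 2, conicMid (C t) (C s) (X * x 0) (X * x 1) + X * x 3,
    -(X * x 1) ^ 2 + X * x 4, ⟨?_, ?_, ?_, ?_, ?_⟩, hP hts ht ha hc h0 h2',
    hP hts.symm hs hb hc' h1 h4⟩
  · exact quartic_degen_tangentPoint X m (hroot ht) ha h0
  · exact quarticPolar₁_degen_tangentPoint X m hc h2'
  · exact quarticPolar₂_degen_tangentPoint X m hc h3
  · rw [tp, tp, ← hsymm]
    exact quarticPolar₁_degen_tangentPoint X m hc' h4
  · exact quartic_degen_tangentPoint X m (hroot hs) hb h1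

open PowerSeries in
/-- The degeneration of a double conic has the infinitely near bitangents joining the eight
branch points in pairs. -/
theorem exists_secantData {E : Type*} [Field E] [CharZero E] (m : Fin 15 → PowerSeries E) :
    ∃ (τ : Fin 8 → E) (α : Fin 8 → Fin 8 → PowerSeries E) (g : Fin 8 → Fin 8 → E),
      SecantData τ α g ∧ ∀ i j, i ≠ j →
        ∃ p q r, IsSquareOn (degenCoeff X m) (ends τ α i j) (ends τ α j i) p q r := by
  let v : Fin 8 → ℤ := ![1, 2, 3, 4, -1, -2, -3, -4]
  let τ : Fin 8 → E := fun i => v i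
  have h2 : (2 : E) ≠ 0 := two_ne_zero
  have hinj : Function.Injective τ :=
    Int.cast_injective.comp (by decide : Function.Injective v)
  have hτ0 : ∀ i, τ i ≠ 0 := fun i =>
    Int.cast_ne_zero.2 ((by decide : ∀ i, v i ≠ 0) i)
  have hroot : ∀ i, pencilPoly (τ i) = 0 := fun i => by
    have := map_pencilPoly (Int.castRingHom E) (v i)
    rw [(by decide : ∀ i, pencilPoly (v i) = 0) i, map_zero] at this
    exact this.symm
  have hder : ∀ i, pencilDeriv (τ i) ≠ 0 := fun i => by
    have := map_pencilDeriv (Int.castRingHom E) (v i)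
    simp only [eq_intCast] at this
    rw [← this]
    exact Int.cast_ne_zero.2 ((by decide : ∀ i, pencilDeriv (v i) ≠ 0) i)
  clear_value τ
  have key : ∀ i j, i < j → _ := fun i j hij => exists_bitangent_degen h2 m (hτ0 i) (hτ0 j)
    (hinj.ne hij.ne) (hroot i) (hroot j) (hder i) (hder j)
  choose! α β p q r hsq hα hβ using key
  let γ : Fin 8 → Fin 8 → PowerSeries E := fun i j => if i < j then α i j else β j i
  let g : Fin 8 → Fin 8 → E := fun i j => pencilDeriv (τ i) * (τ i + τ j) / (2 * (τ j - τ i))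
  have hγ : ∀ i j, i ≠ j → constantCoeff (γ i j) * (2 * τ i * pencilDeriv (τ i))
      + quartic (fun n => constantCoeff (m n)) ![1, τ i, τ i ^ 2] = g i j ^ 2 := by
    intro i j hij
    rcases hij.lt_or_gt with h | h
    · simpa [γ, h] using hα i j h
    · simpa [γ, h.not_gt] using hβ j i h
  refine ⟨τ, γ, g, ⟨h2, hinj, ?_, ?_⟩, ?_⟩
  · intro i j k hij hik hjk h
    have h1 := sub_ne_zero.2 (hinj.ne hij.symm)
    have h3 := sub_ne_zero.2 (hinj.ne hik.symm)
    simp only [g] at h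
    rw [div_eq_div_iff (mul_ne_zero h2 h1) (mul_ne_zero h2 h3)] at h
    have : 4 * pencilDeriv (τ i) * τ i * (τ k - τ j) = 0 := by linear_combination h
    simp [hder, hτ0, sub_eq_zero, hinj.ne hjk.symm] at this
  · intro i j k hij hik hjk
    have h1 := sub_ne_zero.2 (hinj.ne hij.symm)
    have h3 := sub_ne_zero.2 (hinj.ne hik.symm)
    have e1 := hγ i j hij
    have e2 := hγ i k hik
    have e3 : (constantCoeff (γ i k) - constantCoeff (γ i j)) * (2 * τ i * pencilDeriv (τ i)) =
      (g i k - g i j) * (g i j + g i k) := by linear_combination e2 - e1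
    have e4 : (g i k - g i j) * (2 * (τ j - τ i) * (τ k - τ i)) =
        -(2 * τ i * pencilDeriv (τ i)) * (τ k - τ j) := by
      simp only [g]
      field_simp
      ring
    refine mul_right_cancel₀ (mul_ne_zero (mul_ne_zero h2 (hτ0 i)) (hder i)) ?_
    linear_combination (2 * (τ j - τ i) * (τ k - τ i)) * e3 + (g i j + g i k) * e4
  · intro i j hij
    rcases hij.lt_or_gt with h | h
    · exact ⟨_, _, _, by simpa [ends, γ, h, h.not_gt] using hsq i j h⟩
    · exact ⟨_, _, _, by simpa [ends, γ, h, h.not_gt] using (hsq j i h).symm⟩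

section Generic

/-- The exponent vector of a monomial of degree four. -/
def quarticExpFun (n : Fin 15) (i : Fin 3) : ℕ :=
  ∑ k, if quarticIdx n k = i then 1 else 0

/-- The exponent vector of a monomial of degree four, as an index of a coefficient. -/
noncomputable def quarticExp (n : Fin 15) : {d : Fin 3 →₀ ℕ // ∑ i, d i = 4} :=
  ⟨Finsupp.equivFunOnFinite.symm (quarticExpFun n), by
    simp only [Finsupp.equivFunOnFinite_symm_apply_apply]
    exact (by decide : ∀ n, ∑ i, quarticExpFun n i = 4) n⟩

theorem quarticExp_bijective : Function.Bijective quarticExp := by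
  constructor
  · intro a b h
    have h1 : quarticExpFun a = quarticExpFun b :=
      Finsupp.equivFunOnFinite.symm.injective (congrArg Subtype.val h)
    have h2 : ∀ a b, (∀ i, quarticExpFun a i = quarticExpFun b i) → a = b := by decide
    exact h2 a b (congrFun h1)
  · rintro ⟨d, hd⟩
    have h2 : ∀ a b c : Fin 5, (a : ℕ) + b + c = 4 → ∃ n, quarticExpFun n 0 = a ∧
        quarticExpFun n 1 = b ∧ quarticExpFun n 2 = c := by decide
    have hd' := hd
    simp only [Fin.sum_univ_three] at hd'
    obtain ⟨n, h0, h1, h2⟩ := h2 ⟨d 0, by omega⟩ ⟨d 1, by omega⟩ ⟨d 2, by omega⟩ hd'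
    refine ⟨n, Subtype.ext (Finsupp.ext fun i => ?_)⟩
    fin_cases i
    · exact h0
    · exact h1
    · exact h2

instance : Finite {d : Fin 3 →₀ ℕ // ∑ i, d i = 4} :=
  Finite.of_surjective quarticExp quarticExp_bijective.2

theorem MvPolynomial.IsHomogeneous.eval_eq_quartic {R : Type*} [CommRing R]
    {F : MvPolynomial (Fin 3) R} (hF : F.IsHomogeneous 4) (x : Fin 3 → R) :
    MvPolynomial.eval x F = quartic (fun n => F.coeff (quarticExp n).1) x := by
  have hsub : F.support ⊆ Finset.univ.image fun n => (quarticExp n).1 := by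
    intro d hd
    have h := hF (MvPolynomial.mem_support_iff.1 hd)
    rw [Finsupp.weight_apply, Finsupp.sum_fintype _ _ (by simp)] at h
    obtain ⟨n, hn⟩ := quarticExp_bijective.2 ⟨d, by simpa using h⟩
    exact Finset.mem_image.2 ⟨n, Finset.mem_univ _, by rw [hn]⟩
  rw [MvPolynomial.eval_eq', Finset.sum_subset hsub, Finset.sum_image, quartic]
  · refine Finset.sum_congr rfl fun n _ => ?_
    congr 1
    have h1 : ∀ i, x i ^ (quarticExp n).1 i = ∏ k, if quarticIdx n k = i then x i else 1 :=
      fun i => by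
        rw [show (quarticExp n).1 i = quarticExpFun n i from rfl, quarticExpFun,
          ← Finset.prod_pow_eq_pow_sum]
        exact Finset.prod_congr rfl fun k _ => by split_ifs <;> simp
    simp only [h1]
    rw [Finset.prod_comm]
    simp [Fin.prod_univ_four]
  · exact fun a _ b _ h => quarticExp_bijective.1 (Subtype.ext h)
  · intro d _ hd
    rw [MvPolynomial.notMem_support_iff.1 hd, zero_mul]

open PowerSeries in
/-- The ring homomorphism substituting the degeneration for the generic quartic. -/
noncomputable def degenHom (R : Type*) [CommRing R] {D : Type*} (c e : D → ℤ) :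
    MvPolynomial D R →+* PowerSeries (FractionRing (MvPolynomial D R)) :=
  MvPolynomial.eval₂Hom
    (C.comp ((algebraMap (MvPolynomial D R) _).comp MvPolynomial.C))
    fun d => (c d : PowerSeries (FractionRing (MvPolynomial D R)))
      + X * ((e d : PowerSeries (FractionRing (MvPolynomial D R)))
        + X * C (algebraMap (MvPolynomial D R) _ (MvPolynomial.X d)))

theorem degenHom_injective (R : Type*) [CommRing R] [IsDomain R] {D : Type*} (c e : D → ℤ) :
    Function.Injective (degenHom R c e) := by
  let S := MvPolynomial D R
  let f : S →+* Polynomial S :=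
    MvPolynomial.eval₂Hom (Polynomial.C.comp MvPolynomial.C) fun d => (c d : Polynomial S)
      + Polynomial.X * ((e d : Polynomial S) + Polynomial.X * Polynomial.C (MvPolynomial.X d))
  have hf : degenHom R c e = (Polynomial.coeToPowerSeries.ringHom.comp
      (Polynomial.mapRingHom (algebraMap S (FractionRing S)))).comp f := by
    refine MvPolynomial.ringHom_ext (fun r => ?_) fun d => ?_
    · simp [degenHom, f, S]
    · have h : ∀ n : ℤ, ((n : Polynomial (FractionRing S)) : PowerSeries (FractionRing S)) = n :=
        fun n => map_intCast (Polynomial.coeToPowerSeries.ringHom (R := FractionRing S)) n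
      simp only [S] at h
      simp [degenHom, f, S, h]
      ring
  have hinj : Function.Injective f := by
    let b : S →ₐ[R] S := MvPolynomial.aeval fun d => MvPolynomial.X d - (c d + e d : S)
    have : Function.LeftInverse (fun p => b (Polynomial.eval 1 p)) f := by
      intro p
      have h : ((b : S →+* S).comp (Polynomial.evalRingHom 1)).comp f = RingHom.id S := by
        refine MvPolynomial.ringHom_ext (fun r => ?_) fun d => ?_
        · simp [f, b, S, MvPolynomial.algebraMap_eq]
        · simp [f, b, S]
          ring
      exact congrArg (fun g : S →+* S => g p) h
    exact this.injective
  rw [hf]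
  exact ((Polynomial.coe_injective _).comp
    (Polynomial.map_injective _ (IsFractionRing.injective S _))).comp hinj

end Generic

section Plane

variable {k : Type*} [Field k]

theorem lineThrough_dotProduct (u v x : Fin 3 → k) : lineThrough u v ⬝ᵥ x = tri u v x := by
  simp [lineThrough, tri, dotProduct, Fin.sum_univ_three]; ring

theorem lineThrough_swap (u v : Fin 3 → k) : lineThrough v u = -lineThrough u v := by
  ext i; fin_cases i <;> simp [lineThrough] <;> ring

theorem tri_smul_eq (l m n x : Fin 3 → k) :
    tri l m n • x = (l ⬝ᵥ x) • lineThrough m n + (m ⬝ᵥ x) • lineThrough n l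
      + (n ⬝ᵥ x) • lineThrough l m := by
  ext i
  fin_cases i <;> simp [lineThrough, tri, dotProduct, Fin.sum_univ_three] <;> ring

theorem eq_of_dotProduct_eq_zero {l m n x : Fin 3 → k} (h : tri l m n ≠ 0) (hx : l ⬝ᵥ x = 0) :
    x = (m ⬝ᵥ x / tri l m n) • lineThrough n l + (n ⬝ᵥ x / tri l m n) • lineThrough l m := by
  have := tri_smul_eq l m n x
  rw [hx, zero_smul, zero_add] at this
  rw [div_eq_inv_mul, div_eq_inv_mul, mul_smul, mul_smul, ← smul_add, ← this, inv_smul_smul₀ h]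

/-- A quadratic form vanishing at three points of a line vanishes on the line. -/
theorem QuadraticMap.eq_zero_on_line (Q : QuadraticForm k (Fin 3 → k)) {l m n o : Fin 3 → k}
    (hmn : tri l m n ≠ 0) (hmo : tri l m o ≠ 0) (hno : tri l n o ≠ 0)
    (h1 : Q (lineThrough l m) = 0) (h2 : Q (lineThrough l n) = 0) (h3 : Q (lineThrough l o) = 0)
    {x : Fin 3 → k} (hx : l ⬝ᵥ x = 0) : Q x = 0 := by
  have h2' : Q (lineThrough n l) = 0 := by rw [lineThrough_swap, QuadraticMap.map_neg, h2]
  have key : ∀ a b : k, Q (a • lineThrough n l + b • lineThrough l m) =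
      a * b * QuadraticMap.polar Q (lineThrough n l) (lineThrough l m) := by
    intro a b
    rw [QuadraticMap.map_add Q, QuadraticMap.map_smul, QuadraticMap.map_smul, h1, h2',
      QuadraticMap.polar_smul_left, QuadraticMap.polar_smul_right]
    simp; ring
  have e1 : m ⬝ᵥ lineThrough l o = -tri l m o := by
    simp [lineThrough, tri, dotProduct, Fin.sum_univ_three]; ring
  have e2 : n ⬝ᵥ lineThrough l o = -tri l n o := by
    simp [lineThrough, tri, dotProduct, Fin.sum_univ_three]; ring
  have e3 : l ⬝ᵥ lineThrough l o = 0 := by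
    simp [lineThrough, dotProduct, Fin.sum_univ_three]; ring
  rw [eq_of_dotProduct_eq_zero hmn e3, key, e1, e2] at h3
  have hp : QuadraticMap.polar Q (lineThrough n l) (lineThrough l m) = 0 := by
    simpa [hmn, hmo, hno] using h3
  rw [eq_of_dotProduct_eq_zero hmn hx, key, hp, mul_zero]

/-- The linear form with the given coefficients. -/
def dotForm (l : Fin 3 → k) : (Fin 3 → k) →ₗ[k] k where
  toFun x := l ⬝ᵥ x
  map_add' := dotProduct_add l
  map_smul' c x := dotProduct_smul c l x

/-- Conics prescribed on five lines in general position, compatibly, come from one conic. -/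
theorem exists_quadraticForm_of_lines {L : Fin 5 → Fin 3 → k}
    (hL : ∀ a b c, a ≠ b → a ≠ c → b ≠ c → tri (L a) (L b) (L c) ≠ 0)
    (q : Fin 5 → QuadraticForm k (Fin 3 → k))
    (hq : ∀ a b, a ≠ b → q a (lineThrough (L a) (L b)) = q b (lineThrough (L a) (L b))) :
    ∃ Q : QuadraticForm k (Fin 3 → k), ∀ a x, L a ⬝ᵥ x = 0 → Q x = q a x := by
  let d := tri (L 0) (L 1) (L 2)
  have hd : d ≠ 0 := hL 0 1 2 (by decide) (by decide) (by decide)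
  let w0 := lineThrough (L 1) (L 2)
  let w1 := lineThrough (L 2) (L 0)
  let w2 := lineThrough (L 0) (L 1)
  let f0 := (d⁻¹ • dotForm (L 0))
  let f1 := (d⁻¹ • dotForm (L 1))
  let f2 := (d⁻¹ • dotForm (L 2))
  have hq' : ∀ a b, a ≠ b → q a (lineThrough (L b) (L a)) = q b (lineThrough (L b) (L a)) :=
    fun a b h => (hq b a h.symm).symm
  let Q : QuadraticForm k (Fin 3 → k) :=
    (q 0).comp (f1.smulRight w1 + f2.smulRight w2) + (q 1).comp (f2.smulRight w2 + f0.smulRight w0)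
      + (q 2).comp (f0.smulRight w0 + f1.smulRight w1)
      - (q 1 w0) • QuadraticMap.linMulLin f0 f0 - (q 2 w1) • QuadraticMap.linMulLin f1 f1
      - (q 0 w2) • QuadraticMap.linMulLin f2 f2
  have hx : ∀ x, x = f0 x • w0 + f1 x • w1 + f2 x • w2 := by
    intro x
    have := congrArg (d⁻¹ • ·) (tri_smul_eq (L 0) (L 1) (L 2) x)
    simp only [smul_add, smul_smul] at this
    rw [inv_mul_cancel₀ hd, one_smul] at this
    exact this
  have hQ : ∀ x, Q x = q 0 (f1 x • w1 + f2 x • w2) + q 1 (f2 x • w2 + f0 x • w0)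
      + q 2 (f0 x • w0 + f1 x • w1) - q 1 w0 * (f0 x * f0 x) - q 2 w1 * (f1 x * f1 x)
      - q 0 w2 * (f2 x * f2 x) := fun x => by
    simp [Q]
  have h012 : ∀ a : Fin 5, a = 0 ∨ a = 1 ∨ a = 2 → ∀ x, L a ⬝ᵥ x = 0 → Q x = q a x := by
    have c1 := hq 1 2 (by decide)
    have c2 := hq 2 0 (by decide)
    have c3 := hq 0 1 (by decide)
    have g : ∀ a x, L a ⬝ᵥ x = 0 → (d⁻¹ • dotForm (L a)) x = 0 := fun a x h => by
      simp [dotForm, h]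
    rintro a (rfl | rfl | rfl) x h
    · have h0 : f0 x = 0 := g _ x h
      conv_rhs => rw [hx x]
      rw [hQ, h0]
      simp only [zero_smul, zero_add, add_zero, QuadraticMap.map_smul, smul_eq_mul]
      rw [show q 2 w1 = q 0 w1 from c2, show q 1 w2 = q 0 w2 from c3.symm]
      ring
    · have h0 : f1 x = 0 := g _ x h
      conv_rhs => rw [hx x]
      rw [hQ, h0]
      simp only [zero_smul, zero_add, add_zero, QuadraticMap.map_smul, smul_eq_mul]
      rw [show q 2 w0 = q 1 w0 from c1.symm, show q 0 w2 = q 1 w2 from c3,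
        add_comm (f2 x • w2)]
      ring
    · have h0 : f2 x = 0 := g _ x h
      conv_rhs => rw [hx x]
      rw [hQ, h0]
      simp only [zero_smul, zero_add, add_zero, QuadraticMap.map_smul, smul_eq_mul]
      rw [show q 1 w0 = q 2 w0 from c1, show q 0 w1 = q 2 w1 from c2.symm]
      ring
  refine ⟨Q, fun a x hax => ?_⟩
  by_cases ha : a = 0 ∨ a = 1 ∨ a = 2
  · exact h012 a ha x hax
  · push Not at ha
    have hv : ∀ b : Fin 5, b = 0 ∨ b = 1 ∨ b = 2 → a ≠ b →
        (Q - q a) (lineThrough (L a) (L b)) = 0 := fun b hb hab => by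
      rw [_root_.sub_apply, h012 b hb, hq a b hab, sub_self]
      simp [lineThrough, dotProduct, Fin.sum_univ_three]; ring
    have := QuadraticMap.eq_zero_on_line (Q - q a)
      (hL a 0 1 ha.1 ha.2.1 (by decide)) (hL a 0 2 ha.1 ha.2.2 (by decide))
      (hL a 1 2 ha.2.1 ha.2.2 (by decide)) (hv 0 (by simp) ha.1) (hv 1 (by simp) ha.2.1)
      (hv 2 (by simp) ha.2.2) hax
    rwa [_root_.sub_apply, sub_eq_zero] at this

end Plane

section Polynomials

variable {k : Type*} [Field k]

open MvPolynomial in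
/-- The linear form with the given coefficients, as a polynomial. -/
noncomputable def linPoly (l : Fin 3 → k) : MvPolynomial (Fin 3) k := ∑ i, C (l i) * X i

theorem eval_linPoly (l x : Fin 3 → k) : MvPolynomial.eval x (linPoly l) = l ⬝ᵥ x := by
  simp [linPoly, dotProduct]

theorem linPoly_ne_zero {l : Fin 3 → k} (h : l ≠ 0) : linPoly l ≠ 0 := by
  intro h0
  refine h (funext fun i => ?_)
  have := eval_linPoly l (Pi.single i 1)
  rw [h0] at this
  simpa using this.symm

theorem tri_eq_zero_of_smul_eq {l m n : Fin 3 → k} {a b : k} (hb : b ≠ 0) (h : a • l = b • m) :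
    tri l m n = 0 := by
  have hm : m = (b⁻¹ * a) • l := by rw [mul_smul, h, inv_smul_smul₀ hb]
  rw [hm]
  simp [tri]; ring

open MvPolynomial in
/-- A plane quartic containing five lines in general position vanishes identically. -/
theorem eq_zero_of_five_lines [Infinite k] {H : MvPolynomial (Fin 3) k} (hH : H.totalDegree ≤ 4)
    {L : Fin 5 → Fin 3 → k} (hL : ∀ a b c, a ≠ b → a ≠ c → b ≠ c → tri (L a) (L b) (L c) ≠ 0)
    (h : ∀ a x, L a ⬝ᵥ x = 0 → eval x H = 0) : H = 0 := by
  have hthird : ∀ a b : Fin 5, ∃ c, a ≠ c ∧ b ≠ c := by decide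
  have hother : ∀ a : Fin 5, ∃ b, a ≠ b := by decide
  have hL0 : ∀ a, L a ≠ 0 := fun a h0 => by
    obtain ⟨b, hb⟩ := hother a
    obtain ⟨c, hac, hbc⟩ := hthird a b
    refine hL a b c hb hac hbc ?_
    simp [h0, tri]
  have hprod : ∏ a, linPoly (L a) ≠ 0 := Finset.prod_ne_zero_iff.2 fun a _ => linPoly_ne_zero (hL0 a)
  obtain ⟨y, hy⟩ : ∃ y, eval y (∏ a, linPoly (L a)) ≠ 0 := by
    by_contra! h0
    exact hprod (MvPolynomial.funext fun y => by simpa using h0 y)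
  have hy' : ∀ a, L a ⬝ᵥ y ≠ 0 := fun a => by
    rw [map_prod, Finset.prod_ne_zero_iff] at hy
    simpa [eval_linPoly] using hy a (Finset.mem_univ a)
  let M : Fin 5 → Fin 5 → Fin 3 → k := fun a b => (L b ⬝ᵥ y) • L a - (L a ⬝ᵥ y) • L b
  let D : MvPolynomial (Fin 3) k := ∏ p ∈ Finset.univ.filter fun p : Fin 5 × Fin 5 => p.1 ≠ p.2,
    linPoly (M p.1 p.2)
  have hD : D ≠ 0 := Finset.prod_ne_zero_iff.2 fun p hp => linPoly_ne_zero fun h0 => by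
    obtain ⟨c, hac, hbc⟩ := hthird p.1 p.2
    exact hL p.1 p.2 c (Finset.mem_filter.1 hp).2 hac hbc
      (tri_eq_zero_of_smul_eq (hy' p.1) (sub_eq_zero.1 h0))
  suffices H * D = 0 from (mul_eq_zero.1 this).resolve_right hD
  refine MvPolynomial.funext fun x => ?_
  rw [map_mul, map_zero]
  by_cases hx : eval x D = 0
  · rw [hx, mul_zero]
  have hne : ∀ a b, a ≠ b → M a b ⬝ᵥ x ≠ 0 := fun a b hab => by
    rw [map_prod] at hx
    simpa [eval_linPoly] using Finset.prod_ne_zero_iff.1 hx (a, b) (by simp [hab])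
  let p : Polynomial k := aeval (fun i => Polynomial.C (x i) + Polynomial.C (y i) * Polynomial.X) H
  have hp : ∀ s, p.eval s = eval (fun i => x i + y i * s) H := fun s => by
    have : (Polynomial.evalRingHom s).comp (aeval (R := k) fun i =>
        Polynomial.C (x i) + Polynomial.C (y i) * Polynomial.X).toRingHom =
          eval (fun i => x i + y i * s) := by
      refine MvPolynomial.ringHom_ext (fun r => ?_) fun i => ?_ <;> simp
    exact congrArg (fun g : MvPolynomial (Fin 3) k →+* k => g H) this
  have hdeg : p.natDegree ≤ 4 := by
    refine (MvPolynomial.aeval_natDegree_le (m := 4) (n := 1) H hH _ fun i => ?_).trans (by simp)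
    compute_degree
  let f : Fin 5 → k := fun a => -(L a ⬝ᵥ x) / (L a ⬝ᵥ y)
  have hf : Function.Injective f := fun a b hab => by
    by_contra hne'
    refine hne a b hne' ?_
    rw [div_eq_div_iff (hy' a) (hy' b)] at hab
    simp only [M, sub_dotProduct, smul_dotProduct, smul_eq_mul]
    linear_combination -hab
  have hp0 : p = 0 := by
    refine Polynomial.eq_zero_of_natDegree_lt_card_of_eval_eq_zero p hf (fun a => ?_)
      (by rw [Fintype.card_fin]; omega)
    rw [hp]
    refine h a _ ?_
    have : (fun i => x i + y i * f a) = x + f a • y := by ext i; simp [mul_comm]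
    rw [this, dotProduct_add, dotProduct_smul, smul_eq_mul, div_mul_cancel₀ _ (hy' a)]
    ring
  have := hp 0
  rw [hp0] at this
  simp at this
  rw [← this, zero_mul]

open MvPolynomial in
theorem QuadraticMap.exists_mvPolynomial [Invertible (2 : k)]
    (Q : QuadraticForm k (Fin 3 → k)) :
    ∃ P : MvPolynomial (Fin 3) k, P.IsHomogeneous 2 ∧ ∀ x, eval x P = Q x := by
  let B := QuadraticMap.associated (R := k) Q
  refine ⟨∑ i, ∑ j, C (B (Pi.single i 1) (Pi.single j 1)) * (X i * X j), ?_, fun x => ?_⟩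
  · refine IsHomogeneous.sum _ _ _ fun i _ => IsHomogeneous.sum _ _ _ fun j _ => ?_
    simpa using (isHomogeneous_C (Fin 3) (B (Pi.single i 1) (Pi.single j 1))).mul
      ((isHomogeneous_X k i).mul (isHomogeneous_X k j))
  · have hx : x = ∑ i, x i • (Pi.single i 1 : Fin 3 → k) := by
      ext j; simp [Finset.sum_apply, Pi.single_apply]
    have hB : Q x = B x x := (QuadraticMap.associated_eq_self_apply k Q x).symm
    rw [hB]
    conv_rhs => rw [hx]
    simp only [map_sum, LinearMap.sum_apply, map_smul, LinearMap.smul_apply, smul_eq_mul,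
      map_mul, eval_C, eval_X]
    simp only [Finset.mul_sum]
    rw [Finset.sum_comm]
    refine Finset.sum_congr rfl fun i _ => Finset.sum_congr rfl fun j _ => ?_
    ring

theorem QuadraticMap.exists_ne_zero_eq_zero [IsAlgClosed k] (Q : QuadraticForm k (Fin 3 → k)) :
    ∃ x, x ≠ 0 ∧ Q x = 0 := by
  by_cases h0 : Q (Pi.single 0 1) = 0
  · exact ⟨_, by simp, h0⟩
  · let p : Polynomial k := Polynomial.C (Q (Pi.single 0 1)) * Polynomial.X ^ 2
      + Polynomial.C (QuadraticMap.polar Q (Pi.single 0 1) (Pi.single 1 1)) * Polynomial.X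
      + Polynomial.C (Q (Pi.single 1 1))
    obtain ⟨z, hz⟩ := IsAlgClosed.exists_root p (by rw [Polynomial.degree_quadratic h0]; decide)
    refine ⟨z • Pi.single 0 1 + Pi.single 1 1, fun h => ?_, ?_⟩
    · simpa using congrFun h 1
    · rw [QuadraticMap.map_add Q, QuadraticMap.map_smul, QuadraticMap.polar_smul_left]
      simp [p, Polynomial.IsRoot] at hz
      simp only [smul_eq_mul]
      linear_combination hz

end Polynomials

/-- A smooth quartic is not a double conic on five lines in general position. -/
theorem SmoothQuartic.not_square_on_lines {F : MvPolynomial (Fin 3) ℂ} (hF : SmoothQuartic F)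
    {L : Fin 5 → Fin 3 → ℂ} (hL : ∀ a b c, a ≠ b → a ≠ c → b ≠ c → tri (L a) (L b) (L c) ≠ 0)
    (Q : QuadraticForm ℂ (Fin 3 → ℂ))
    (hQ : ∀ a x, L a ⬝ᵥ x = 0 → MvPolynomial.eval x F = Q x ^ 2) : False := by
  obtain ⟨P, hP, hPQ⟩ := QuadraticMap.exists_mvPolynomial Q
  have h0 : F - P ^ 2 = 0 := by
    refine eq_zero_of_five_lines ?_ hL fun a x hx => ?_
    · refine (MvPolynomial.IsHomogeneous.totalDegree_le ?_)
      exact hF.2.1.sub (by simpa using hP.pow 2)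
    · rw [map_sub, map_pow, hPQ, hQ a x hx, sub_self]
  obtain ⟨x, hx, hQx⟩ := QuadraticMap.exists_ne_zero_eq_zero Q
  obtain ⟨i, hi⟩ := hF.2.2 x hx
  rw [sub_eq_zero.1 h0, sq] at hi
  simp [hPQ, hQx] at hi

section Roots

open MvPolynomial

theorem lineThrough_eq_crossProduct {k : Type*} [Field k] (u v : Fin 3 → k) :
    lineThrough u v = crossProduct u v := by
  rw [cross_apply]; rfl

theorem tri_smul_eq_add {k : Type*} [Field k] (u v w x : Fin 3 → k) :
    tri u v w • x = tri x v w • u + tri u x w • v + tri u v x • w := by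
  ext i
  fin_cases i <;> simp [tri] <;> ring

theorem exists_tri_ne_zero {k : Type*} [Field k] {u v : Fin 3 → k} (h : lineThrough u v ≠ 0) :
    ∃ w, tri u v w ≠ 0 := by
  obtain ⟨n, hn⟩ := Function.ne_iff.1 h
  refine ⟨Pi.single n 1, ?_⟩
  rw [← lineThrough_dotProduct]
  simpa using hn

theorem exists_eq_smul_add_smul {k : Type*} [Field k] {u v x : Fin 3 → k}
    (h : lineThrough u v ≠ 0) (hx : tri u v x = 0) : ∃ s t : k, x = s • u + t • v := by
  obtain ⟨w, hw⟩ := exists_tri_ne_zero h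
  have := tri_smul_eq_add u v w x
  rw [hx, zero_smul, add_zero] at this
  refine ⟨(tri u v w)⁻¹ * tri x v w, (tri u v w)⁻¹ * tri u x w, ?_⟩
  rw [mul_smul, mul_smul, ← smul_add, ← this, inv_smul_smul₀ hw]

theorem tri_eq_zero_of_dotProduct {k : Type*} [Field k] {L u v x : Fin 3 → k} (hL : L ≠ 0)
    (hu : L ⬝ᵥ u = 0) (hv : L ⬝ᵥ v = 0) (hx : L ⬝ᵥ x = 0) : tri u v x = 0 := by
  have h := tri_smul_eq u v x L
  rw [dotProduct_comm, hu, dotProduct_comm, hv, dotProduct_comm, hx] at h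
  simp only [zero_smul, add_zero] at h
  exact (smul_eq_zero.1 h).resolve_right hL

theorem IsBitangent.exists_square {G : MvPolynomial (Fin 3) ℂ} {u v : Fin 3 → ℂ}
    (h : IsBitangent G (lineThrough u v)) : ∃ p q r : ℂ, ∀ s t : ℂ,
      eval (fun i => s * u i + t * v i) G = (p * s ^ 2 + q * s * t + r * t ^ 2) ^ 2 := by
  obtain ⟨hL, w₁, w₂, hw, h1, h2, α, β, γ, hG⟩ := h
  rw [← crossProduct_ne_zero_iff_linearIndependent, ← lineThrough_eq_crossProduct] at hw
  have hu : lineThrough u v ⬝ᵥ u = 0 := by rw [lineThrough_dotProduct]; simp [tri]; ring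
  have hv : lineThrough u v ⬝ᵥ v = 0 := by rw [lineThrough_dotProduct]; simp [tri]; ring
  obtain ⟨a, b, rfl⟩ := exists_eq_smul_add_smul hw (tri_eq_zero_of_dotProduct hL h1 h2 hu)
  obtain ⟨c, d, rfl⟩ := exists_eq_smul_add_smul hw (tri_eq_zero_of_dotProduct hL h1 h2 hv)
  refine ⟨α * a ^ 2 + β * a * b + γ * b ^ 2, 2 * α * a * c + β * (a * d + b * c) + 2 * γ * b * d,
    α * c ^ 2 + β * c * d + γ * d ^ 2, fun s t => ?_⟩
  have := hG (s * a + t * c) (s * b + t * d)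
  rw [show (fun i => s * (a • w₁ + b • w₂) i + t * (c • w₁ + d • w₂) i)
    = fun i => (s * a + t * c) * w₁ i + (s * b + t * d) * w₂ i by
      ext i; simp only [Pi.add_apply, Pi.smul_apply, smul_eq_mul]; ring, this]
  ring

theorem isBitangent_lineThrough {G : MvPolynomial (Fin 3) ℂ} {u v : Fin 3 → ℂ}
    (huv : lineThrough u v ≠ 0) {p q r : ℂ} (h : ∀ s t : ℂ,
      eval (fun i => s * u i + t * v i) G = (p * s ^ 2 + q * s * t + r * t ^ 2) ^ 2) :
    IsBitangent G (lineThrough u v) := by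
  refine ⟨huv, u, v, ?_, ?_, ?_, p, q, r, h⟩
  · rwa [← crossProduct_ne_zero_iff_linearIndependent, ← lineThrough_eq_crossProduct]
  · change lineThrough u v ⬝ᵥ u = 0
    rw [lineThrough_dotProduct]; simp [tri]; ring
  · change lineThrough u v ⬝ᵥ v = 0
    rw [lineThrough_dotProduct]; simp [tri]; ring

theorem exists_quadraticForm_of_line {k : Type*} [Field k] {u v : Fin 3 → k}
    (huv : lineThrough u v ≠ 0) (p q r : k) : ∃ Q : QuadraticForm k (Fin 3 → k), ∀ s t : k,
      Q (s • u + t • v) = p * s ^ 2 + q * s * t + r * t ^ 2 := by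
  obtain ⟨w, hw⟩ := exists_tri_ne_zero huv
  let S := dotForm ((tri u v w)⁻¹ • lineThrough v w)
  let T := dotForm ((tri u v w)⁻¹ • lineThrough w u)
  have hS : ∀ s t : k, S (s • u + t • v) = s := fun s t => by
    change ((tri u v w)⁻¹ • lineThrough v w) ⬝ᵥ (s • u + t • v) = _
    rw [smul_dotProduct, lineThrough_dotProduct, smul_eq_mul, inv_mul_eq_iff_eq_mul₀ hw]
    simp [tri]; ring
  have hT : ∀ s t : k, T (s • u + t • v) = t := fun s t => by
    change ((tri u v w)⁻¹ • lineThrough w u) ⬝ᵥ (s • u + t • v) = _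
    rw [smul_dotProduct, lineThrough_dotProduct, smul_eq_mul, inv_mul_eq_iff_eq_mul₀ hw]
    simp [tri]; ring
  refine ⟨p • QuadraticMap.linMulLin S S + q • QuadraticMap.linMulLin S T
    + r • QuadraticMap.linMulLin T T, fun s t => ?_⟩
  simp only [_root_.add_apply, _root_.smul_apply, QuadraticMap.linMulLin_apply, hS, hT,
    smul_eq_mul]
  ring

/-- Square roots of the restrictions of `F` to the lines of a configuration: on the line `ij` the
polynomial `F` is the square of the binary quadratic form with coefficients
`a i j, b i j, a j i`. -/
structure IsRoot (F : MvPolynomial (Fin 3) ℂ) (u : Fin 8 → Fin 8 → Fin 3 → ℂ)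
    (a b : Fin 8 → Fin 8 → ℂ) : Prop where
  diag : ∀ i, a i i = 0
  diag' : ∀ i, b i i = 0
  symm : ∀ i j, b i j = b j i
  eq : ∀ i j, i ≠ j → ∀ s t : ℂ, eval (fun n => s * u i j n + t * u j i n) F =
    (a i j * s ^ 2 + b i j * s * t + a j i * t ^ 2) ^ 2

variable {F : MvPolynomial (Fin 3) ℂ} {u : Fin 8 → Fin 8 → Fin 3 → ℂ} {a b : Fin 8 → Fin 8 → ℂ}

theorem exists_isRoot (h : ∀ i j, i ≠ j → ∃ p q r : ℂ, ∀ s t : ℂ,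
    eval (fun n => s * u i j n + t * u j i n) F = (p * s ^ 2 + q * s * t + r * t ^ 2) ^ 2) :
    ∃ a b, IsRoot F u a b := by
  have h' : ∀ i j, ∃ p q r : ℂ, i ≠ j → ∀ s t : ℂ, eval (fun n => s * u i j n + t * u j i n) F =
      (p * s ^ 2 + q * s * t + r * t ^ 2) ^ 2 := fun i j => by
    by_cases hij : i = j
    · exact ⟨0, 0, 0, fun h => absurd hij h⟩
    · obtain ⟨p, q, r, hpqr⟩ := h i j hij
      exact ⟨p, q, r, fun _ => hpqr⟩
  choose p q r hpqr using h'
  refine ⟨fun i j => if i < j then p i j else if j < i then r j i else 0,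
    fun i j => if i < j then q i j else if j < i then q j i else 0, by simp, by simp,
    fun i j => ?_, fun i j hij s t => ?_⟩
  · rcases lt_trichotomy i j with h | h | h
    · simp [h, h.asymm]
    · rw [h]
    · simp [h, h.asymm]
  · rcases lt_or_gt_of_ne hij with h | h
    · simpa [h, h.asymm] using hpqr i j hij s t
    · have := hpqr j i hij.symm t s
      simp only [h, h.asymm, if_true, if_false]
      rw [show (fun n => s * u i j n + t * u j i n) = fun n => t * u j i n + s * u i j n by
        ext n; ring, this]
      ring

/-- The intersection point of two lines of a configuration. -/
def meet (u : Fin 8 → Fin 8 → Fin 3 → ℂ) (i j k l : Fin 8) : Fin 3 → ℂ :=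
  lineThrough (lineThrough (u i j) (u j i)) (lineThrough (u k l) (u l k))

theorem meet_eq (u : Fin 8 → Fin 8 → Fin 3 → ℂ) (i j k l : Fin 8) :
    meet u i j k l = -tri (u j i) (u k l) (u l k) • u i j + tri (u i j) (u k l) (u l k) • u j i := by
  ext n
  fin_cases n <;> simp [meet, lineThrough, tri] <;> ring

theorem meet_eq' (u : Fin 8 → Fin 8 → Fin 3 → ℂ) (i j k l : Fin 8) :
    meet u i j k l = tri (u l k) (u i j) (u j i) • u k l + -tri (u k l) (u i j) (u j i) • u l k := by
  ext n
  fin_cases n <;> simp [meet, lineThrough, tri] <;> ring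

theorem IsRoot.sq_evalMeet (h : IsRoot F u a b) {i j k l : Fin 8} (hij : i ≠ j) (hkl : k ≠ l) :
    evalMeet u a b i j k l ^ 2 = evalMeet u a b k l i j ^ 2 := by
  have h1 := h.eq i j hij (-tri (u j i) (u k l) (u l k)) (tri (u i j) (u k l) (u l k))
  have h2 := h.eq k l hkl (tri (u l k) (u i j) (u j i)) (-tri (u k l) (u i j) (u j i))
  have h3 := (meet_eq u i j k l).symm.trans (meet_eq' u i j k l)
  have h4 : eval (-tri (u j i) (u k l) (u l k) • u i j + tri (u i j) (u k l) (u l k) • u j i) F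
    = evalMeet u a b i j k l ^ 2 := h1.trans (by simp only [evalMeet]; ring)
  have h5 : eval (tri (u l k) (u i j) (u j i) • u k l + -tri (u k l) (u i j) (u j i) • u l k) F
    = evalMeet u a b k l i j ^ 2 := h2.trans (by simp only [evalMeet]; ring)
  rw [← h4, ← h5, h3]

open Classical in
/-- The signs relating the square roots of `F` at the intersection points of the lines. -/
noncomputable def meetSign (u : Fin 8 → Fin 8 → Fin 3 → ℂ) (a b : Fin 8 → Fin 8 → ℂ)
    (i j k l : Fin 8) : ℤˣ :=
  if evalMeet u a b i j k l = evalMeet u a b k l i j then 1 else -1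

theorem evalMeet_swap_left (hb : ∀ i j, b i j = b j i) (i j k l : Fin 8) :
    evalMeet u a b j i k l = evalMeet u a b i j k l := by
  simp only [evalMeet, hb j i]; ring

theorem evalMeet_swap_right (i j k l : Fin 8) :
    evalMeet u a b i j l k = evalMeet u a b i j k l := by
  simp only [evalMeet, tri]; ring

theorem IsRoot.signSymm (h : IsRoot F u a b) : SignSymm (meetSign u a b) := by
  refine ⟨fun i j k l => ?_, fun i j k l => ?_⟩
  · simp only [meetSign, evalMeet_swap_left h.symm i j k l, evalMeet_swap_right k l i j]
  · simp only [meetSign, eq_comm]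

theorem IsRoot.isSol (h : IsRoot F u a b) : IsSol u (meetSign u a b) a b where
  symm i j _ := h.symm i j
  eq i j k l hij hkl := by
    rcases sq_eq_sq_iff_eq_or_eq_neg.1 (h.sq_evalMeet hij hkl) with h' | h'
    · simp [meetSign, h']
    · by_cases h'' : evalMeet u a b i j k l = evalMeet u a b k l i j
      · simp [meetSign, h'']
      · simpa [meetSign, h''] using h'

theorem IsRoot.not_hasGoodClique (h : IsRoot F u a b) (hF : SmoothQuartic F) :
    ¬ HasGoodClique u (meetSign u a b) := by
  rintro ⟨f, g, e, hfg, he, ht⟩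
  let L : Fin 5 → Fin 3 → ℂ := fun x => lineThrough (u (f x) (g x)) (u (g x) (f x))
  have hL : ∀ x y z, x ≠ y → x ≠ z → y ≠ z → tri (L x) (L y) (L z) ≠ 0 := ht
  have hL0 : ∀ x, L x ≠ 0 := fun x h0 => by
    obtain ⟨y, z, hxy, hxz, hyz⟩ : ∃ y z : Fin 5, x ≠ y ∧ x ≠ z ∧ y ≠ z := by
      clear h0; revert x; decide
    exact hL x y z hxy hxz hyz (by simp [h0, tri])
  have hee : ∀ x, ((e x : ℤ) : ℂ) ^ 2 = 1 := fun x => by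
    rcases Int.units_eq_one_or (e x) with h | h <;> simp [h]
  choose q hq using fun x => exists_quadraticForm_of_line (hL0 x)
    ((e x : ℤ) * a (f x) (g x)) ((e x : ℤ) * b (f x) (g x)) ((e x : ℤ) * a (g x) (f x))
  have hagree : ∀ x y, x ≠ y → q x (lineThrough (L x) (L y)) = q y (lineThrough (L x) (L y)) := by
    intro x y hxy
    change q x (meet u (f x) (g x) (f y) (g y)) = q y (meet u (f x) (g x) (f y) (g y))
    have h1 := h.isSol.eq (f x) (g x) (f y) (g y) (hfg x) (hfg y)
    rw [he x y hxy] at h1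
    push_cast at h1
    have h2 : q x (meet u (f x) (g x) (f y) (g y))
        = (e x : ℤ) * evalMeet u a b (f x) (g x) (f y) (g y) := by
      rw [meet_eq, hq]; simp only [evalMeet]; ring
    have h3 : q y (meet u (f x) (g x) (f y) (g y))
        = (e y : ℤ) * evalMeet u a b (f y) (g y) (f x) (g x) := by
      rw [meet_eq', hq]; simp only [evalMeet]; ring
    rw [h2, h3, h1]
    linear_combination (e y : ℂ) * evalMeet u a b (f y) (g y) (f x) (g x) * hee x
  obtain ⟨Q, hQ⟩ := exists_quadraticForm_of_lines hL q hagree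
  refine hF.not_square_on_lines hL Q fun x y hy => ?_
  rw [hQ x y hy]
  obtain ⟨s, t, rfl⟩ := exists_eq_smul_add_smul (hL0 x) (by rwa [← lineThrough_dotProduct])
  rw [hq]
  refine (h.eq _ _ (hfg x) s t).trans ?_
  linear_combination -(a (f x) (g x) * s ^ 2 + b (f x) (g x) * s * t
    + a (g x) (f x) * t ^ 2) ^ 2 * hee x

end Roots

section Uniqueness

open MvPolynomial

variable {F G : MvPolynomial (Fin 3) ℂ} {u : Fin 8 → Fin 8 → Fin 3 → ℂ} {a b : Fin 8 → Fin 8 → ℂ}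

/-- A configuration of lines `ij`, spanned by `u i j` and `u j i`, which satisfies the
nondegeneracy conditions of the lines through pairs of points on a conic. -/
structure IsGeneralConfig (u : Fin 8 → Fin 8 → Fin 3 → ℂ) : Prop where
  star : ∀ i j k l, i ≠ j → i ≠ k → i ≠ l → j ≠ k → j ≠ l → k ≠ l → triLines u i j i k i l ≠ 0
  steiner : ∀ σ, SignSymm σ → ¬ HasGoodClique u σ → IsSteiner σ → ∃ N, IsLeftInv u σ 1 N
  not_steiner : ∀ σ, SignSymm σ → ¬ HasGoodClique u σ → ¬ IsSteiner σ → ∃ N, IsLeftInv u σ 0 N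

theorem IsGeneralConfig.lineThrough_ne_zero (h : IsGeneralConfig u) {i j : Fin 8} (hij : i ≠ j) :
    lineThrough (u i j) (u j i) ≠ 0 := by
  intro h0
  obtain ⟨k, l, hk, hl, hjk, hjl, hkl⟩ :
      ∃ k l : Fin 8, i ≠ k ∧ i ≠ l ∧ j ≠ k ∧ j ≠ l ∧ k ≠ l := by
    clear h0 hij; revert i j; decide
  refine h.star i j k l hij hk hl hjk hjl hkl ?_
  simp [triLines, h0, tri]

theorem IsGeneralConfig.eq_zero (h : IsGeneralConfig u) (hF : F.totalDegree ≤ 4)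
    (h0 : ∀ i j, i ≠ j → ∀ s t : ℂ, eval (fun n => s * u i j n + t * u j i n) F = 0) : F = 0 := by
  let f : Fin 5 → Fin 8 := ![1, 2, 3, 4, 5]
  have hf : ∀ x y, x ≠ y → f x ≠ f y := by decide
  have hf0 : ∀ x, 0 ≠ f x := by decide
  refine eq_zero_of_five_lines hF (L := fun x => lineThrough (u 0 (f x)) (u (f x) 0))
    (fun x y z hxy hxz hyz => ?_) fun x y hy => ?_
  · exact h.star 0 (f x) (f y) (f z) (hf0 x) (hf0 y) (hf0 z) (hf _ _ hxy) (hf _ _ hxz) (hf _ _ hyz)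
  · obtain ⟨s, t, rfl⟩ := exists_eq_smul_add_smul (h.lineThrough_ne_zero (hf0 x))
      (by rwa [← lineThrough_dotProduct])
    exact h0 _ _ (hf0 x) s t

theorem evalMeet_self (i j : Fin 8) : evalMeet u a b i j i j = 0 := by
  simp only [evalMeet, tri]; ring

theorem evalMeet_self_swap (i j : Fin 8) : evalMeet u a b i j j i = 0 := by
  simp only [evalMeet, tri]; ring

theorem IsRoot.twist (h : IsRoot F u a b) {e : Fin 8 → Fin 8 → ℤˣ} (he : ∀ i j, e i j = e j i) :
    IsRoot F u (fun i j => (e i j : ℤ) * a i j) (fun i j => (e i j : ℤ) * b i j) where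
  diag i := by simp [h.diag]
  diag' i := by simp [h.diag']
  symm i j := by rw [he i j, h.symm i j]
  eq i j hij s t := by
    have : ((e i j : ℤ) : ℂ) ^ 2 = 1 := by
      rcases Int.units_eq_one_or (e i j) with h | h <;> simp [h]
    rw [h.eq i j hij, he j i]
    linear_combination -(a i j * s ^ 2 + b i j * s * t + a j i * t ^ 2) ^ 2 * this

theorem IsSol.twist {σ σ' : Fin 8 → Fin 8 → Fin 8 → Fin 8 → ℤˣ} (h : IsSol u σ a b)
    {e : Fin 8 → Fin 8 → ℤˣ} (he : ∀ i j, e i j = e j i)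
    (hσ : ∀ i j k l, i ≠ j → k ≠ l → ¬(i = k ∧ j = l) → ¬(i = l ∧ j = k) →
      σ' i j k l = e i j * e k l * σ i j k l) :
    IsSol u σ' (fun i j => (e i j : ℤ) * a i j) (fun i j => (e i j : ℤ) * b i j) where
  symm i j hij := by rw [he i j, h.symm i j hij]
  eq i j k l hij hkl := by
    by_cases h1 : i = k ∧ j = l
    · rw [h1.1, h1.2, evalMeet_self, mul_zero]
    by_cases h2 : i = l ∧ j = k
    · rw [h2.1, h2.2, evalMeet_self_swap, evalMeet_self_swap, mul_zero]
    have hE : ∀ i j k l, evalMeet u (fun i j => (e i j : ℤ) * a i j) (fun i j => (e i j : ℤ) * b i j)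
        i j k l = (e i j : ℤ) * evalMeet u a b i j k l := fun i j k l => by
      simp only [evalMeet, he j i]; ring
    have hee : ((e k l : ℤ) : ℂ) ^ 2 = 1 := by
      rcases Int.units_eq_one_or (e k l) with h | h <;> simp [h]
    rw [hE, hE, hσ i j k l hij hkl h1 h2, h.eq i j k l hij hkl]
    push_cast
    linear_combination -((e i j : ℤ) : ℂ) * (σ i j k l : ℤ) * evalMeet u a b k l i j * hee

theorem IsSol.comb {σ : Fin 8 → Fin 8 → Fin 8 → Fin 8 → ℤˣ} {a' b' : Fin 8 → Fin 8 → ℂ}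
    (h : IsSol u σ a b) (h' : IsSol u σ a' b') (x y : ℂ) :
    IsSol u σ (fun i j => x * a i j + y * a' i j) fun i j => x * b i j + y * b' i j where
  symm i j hij := by rw [h.symm i j hij, h'.symm i j hij]
  eq i j k l hij hkl := by
    have hE : ∀ i j k l, evalMeet u (fun i j => x * a i j + y * a' i j)
        (fun i j => x * b i j + y * b' i j) i j k l =
          x * evalMeet u a b i j k l + y * evalMeet u a' b' i j k l := fun i j k l => by
      simp only [evalMeet]; ring
    rw [hE, hE, h.eq i j k l hij hkl, h'.eq i j k l hij hkl]
    ring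

theorem IsLeftInv.sol_eq_zero {σ : Fin 8 → Fin 8 → Fin 8 → Fin 8 → ℤˣ} {c : ℤ} {N}
    (hN : IsLeftInv u σ c N) (h : IsSol u σ a b) (ha : ∀ i, a i i = 0) (hb : ∀ i, b i i = 0)
    (hc : (c : ℂ) * b 0 1 = 0) (i j : Fin 8) : a i j = 0 ∧ b i j = 0 := by
  have := hN.eq_zero (h.sysMap_eq_zero ha hb hc)
  exact ⟨congrFun this (true, i, j), congrFun this (false, i, j)⟩

theorem IsRoot.exists_ne_zero (h : IsRoot F u a b) (hu : IsGeneralConfig u)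
    (hF : SmoothQuartic F) : ∃ i j, ¬ (a i j = 0 ∧ b i j = 0) := by
  by_contra! h0
  refine hF.1 (hu.eq_zero hF.2.1.totalDegree_le fun i j hij s t => ?_)
  rw [h.eq i j hij, (h0 i j).1, (h0 i j).2, (h0 j i).1]
  ring

theorem IsRoot.isSteiner (h : IsRoot F u a b) (hu : IsGeneralConfig u) (hF : SmoothQuartic F) :
    IsSteiner (meetSign u a b) := by
  by_contra hσ
  obtain ⟨N, hN⟩ := hu.not_steiner _ h.signSymm (h.not_hasGoodClique hF) hσ
  obtain ⟨i, j, hij⟩ := h.exists_ne_zero hu hF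
  exact hij (hN.sol_eq_zero h.isSol h.diag h.diag' (by simp) i j)

/-- Two smooth quartics sharing the lines of a general configuration as bitangents are
proportional. -/
theorem IsGeneralConfig.eq_smul (hu : IsGeneralConfig u) (hF : SmoothQuartic F)
    (hG : SmoothQuartic G) (hFu : ∀ i j, i ≠ j → IsBitangent F (lineThrough (u i j) (u j i)))
    (hGu : ∀ i j, i ≠ j → IsBitangent G (lineThrough (u i j) (u j i))) :
    ∃ c : ℂ, c ≠ 0 ∧ G = c • F := by
  obtain ⟨a, b, h⟩ := exists_isRoot fun i j hij => (hFu i j hij).exists_square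
  obtain ⟨a', b', h'⟩ := exists_isRoot fun i j hij => (hGu i j hij).exists_square
  have hσ := h.isSteiner hu hF
  obtain ⟨N, hN⟩ := hu.steiner _ h.signSymm (h.not_hasGoodClique hF) hσ
  obtain ⟨e, he, heσ⟩ := hσ
  obtain ⟨e', he', heσ'⟩ := h'.isSteiner hu hG
  have hee : ∀ i j, e i j * e' i j = e j i * e' j i := fun i j => by rw [he, he']
  have hs := h'.isSol.twist (σ' := meetSign u a b) (e := fun i j => e i j * e' i j) hee
    fun i j k l hij hkl h1 h2 => by
      rw [heσ i j k l hij hkl h1 h2, heσ' i j k l hij hkl h1 h2]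
      rcases Int.units_eq_one_or (e' i j) with h | h <;>
        rcases Int.units_eq_one_or (e' k l) with h' | h' <;> simp [h, h']
  have hr := h'.twist (e := fun i j => e i j * e' i j) hee
  generalize (fun i j => (((e i j * e' i j : ℤˣ) : ℤ) : ℂ) * a' i j) = a'' at hs hr
  generalize (fun i j => (((e i j * e' i j : ℤˣ) : ℤ) : ℂ) * b' i j) = b'' at hs hr
  have hb : b 0 1 ≠ 0 := fun h0 => by
    obtain ⟨i, j, hij⟩ := h.exists_ne_zero hu hF
    exact hij (hN.sol_eq_zero h.isSol h.diag h.diag' (by simp [h0]) i j)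
  have hb'' : b'' 0 1 ≠ 0 := fun h0 => by
    obtain ⟨i, j, hij⟩ := hr.exists_ne_zero hu hG
    exact hij (hN.sol_eq_zero hs hr.diag hr.diag' (by simp [h0]) i j)
  have key := hN.sol_eq_zero (hs.comb h.isSol (b 0 1) (-b'' 0 1)) (by simp [h.diag, hr.diag])
    (by simp [h.diag', hr.diag']) (by push_cast; ring)
  have ha2 : ∀ i j, a'' i j = b'' 0 1 / b 0 1 * a i j := fun i j => by
    rw [div_mul_eq_mul_div, eq_div_iff hb]
    linear_combination (key i j).1
  have hb2 : ∀ i j, b'' i j = b'' 0 1 / b 0 1 * b i j := fun i j => by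
    rw [div_mul_eq_mul_div, eq_div_iff hb]
    linear_combination (key i j).2
  have hr0 : b'' 0 1 / b 0 1 ≠ 0 := div_ne_zero hb'' hb
  generalize b'' 0 1 / b 0 1 = c at ha2 hb2 hr0
  refine ⟨c ^ 2, pow_ne_zero 2 hr0, sub_eq_zero.1 ?_⟩
  refine hu.eq_zero ?_ fun i j hij s t => ?_
  · exact (hG.2.1.sub ((homogeneousSubmodule (Fin 3) ℂ 4).smul_mem _ hF.2.1)).totalDegree_le
  · rw [map_sub, smul_eval, hr.eq i j hij, h.eq i j hij, ha2 i j, ha2 j i, hb2 i j]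
    ring

end Uniqueness

theorem IsSquareOn.of_map {A B : Type*} [CommRing A] [CommRing B] {φ : A →+* B}
    (hφ : Function.Injective φ) {c : Fin 15 → A} {u v : Fin 3 → A} {p q r : A}
    (h : IsSquareOn (fun n => φ (c n)) (fun i => φ (u i)) (fun i => φ (v i)) (φ p) (φ q) (φ r)) :
    IsSquareOn c u v p q r where
  c0 := hφ (by rw [map_quartic, h.c0, map_pow])
  c1 := hφ (by rw [map_quarticPolar₁, h.c1]; simp [map_ofNat])
  c2 := hφ (by rw [map_quarticPolar₂, h.c2]; simp [map_ofNat])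
  c3 := hφ (by rw [map_quarticPolar₁, h.c3]; simp [map_ofNat])
  c4 := hφ (by rw [map_quartic, h.c4, map_pow])

/-- A general quartic has a general configuration of bitangents. -/
theorem exists_isGeneralConfig :
    ∃ P : MvPolynomial {d : Fin 3 →₀ ℕ // ∑ i, d i = 4} ℂ, P ≠ 0 ∧
      ∀ F : MvPolynomial (Fin 3) ℂ, F.IsHomogeneous 4 →
        MvPolynomial.eval (fun d => F.coeff d.1) P ≠ 0 → ∃ u, IsGeneralConfig u ∧
          ∀ i j, i ≠ j → IsBitangent F (lineThrough (u i j) (u j i)) := by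
  let D := {d : Fin 3 →₀ ℕ // ∑ i, d i = 4}
  let E := FractionRing (MvPolynomial D ℂ)
  have : CharZero E := charZero_of_injective_algebraMap
    (IsFractionRing.injective (MvPolynomial D ℂ) E)
  let K := FractionRing (PowerSeries E)
  let ι : PowerSeries E →+* K := algebraMap _ _
  have hι : Function.Injective ι := IsFractionRing.injective _ _
  let idx : Fin 15 ≃ D := Equiv.ofBijective quarticExp quarticExp_bijective
  let φ : MvPolynomial D ℂ →+* K := ι.comp
    (degenHom ℂ (fun d => conicSqCoeff (idx.symm d)) fun d => pencilCoeff (idx.symm d))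
  have hφ : Function.Injective φ := hι.comp (degenHom_injective ℂ _ _)
  let m : Fin 15 → PowerSeries E := fun n =>
    PowerSeries.C (algebraMap (MvPolynomial D ℂ) E (MvPolynomial.X (idx n)))
  have hφm : ∀ n, φ (MvPolynomial.X (idx n)) = ι (degenCoeff PowerSeries.X m n) := fun n => by
    simp [φ, degenHom, degenCoeff, m]
    exact Or.inl rfl
  obtain ⟨τ, α, g, hu, hsq⟩ := exists_secantData m
  have hsq' : ∀ i j, ∃ p q r, i ≠ j →
      IsSquareOn (degenCoeff PowerSeries.X m) (ends τ α i j) (ends τ α j i) p q r := fun i j => by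
    by_cases hij : i = j
    · exact ⟨0, 0, 0, fun h => absurd hij h⟩
    · obtain ⟨p, q, r, h⟩ := hsq i j hij
      exact ⟨p, q, r, fun _ => h⟩
  choose p q r hpqr using hsq'
  have hinv : ∀ (σ : Fin 8 → Fin 8 → Fin 8 → Fin 8 → ℤˣ) (c : Fin 2), ∃ N, SignSymm σ →
      ¬ HasGoodClique (ends τ α) σ → (IsSteiner σ → c = 1) →
        IsLeftInv (fun i j n => ι (ends τ α i j n)) σ ((c : ℕ) : ℤ) N := fun σ c => by
    by_cases h : SignSymm σ ∧ ¬ HasGoodClique (ends τ α) σ ∧ (IsSteiner σ → c = 1)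
    · obtain ⟨N, hN⟩ := hu.exists_isLeftInv h.1 h.2.1 (c := ((c : ℕ) : ℤ))
        fun hs => by simp [h.2.2 hs]
      exact ⟨N, fun _ _ _ => hN⟩
    · exact ⟨0, fun h1 h2 h3 => absurd ⟨h1, h2, h3⟩ h⟩
  choose N hN using hinv
  let S : Set K := Set.range (fun x : Fin 8 × Fin 8 × Fin 3 => ι (ends τ α x.1 x.2.1 x.2.2)) ∪
    (Set.range (fun x : Fin 8 × Fin 8 => ι (p x.1 x.2)) ∪
    (Set.range (fun x : Fin 8 × Fin 8 => ι (q x.1 x.2)) ∪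
    (Set.range (fun x : Fin 8 × Fin 8 => ι (r x.1 x.2)) ∪
    (Set.range (fun x : (Fin 8 → Fin 8 → Fin 8 → Fin 8 → ℤˣ) × Fin 2 × (Bool × Fin 8 × Fin 8) ×
      Option (Fin 8 × Fin 8 × Fin 8 × Fin 8) => N x.1 x.2.1 x.2.2.1 x.2.2.2) ∪
    Set.range (fun x : Fin 8 × Fin 8 × Fin 8 × Fin 8 × Fin 8 × Fin 8 =>
      (ι (triLines (ends τ α) x.1 x.2.1 x.2.2.1 x.2.2.2.1 x.2.2.2.2.1 x.2.2.2.2.2))⁻¹)))))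
  have hS : S.Finite := (Set.finite_range _).union ((Set.finite_range _).union
    ((Set.finite_range _).union ((Set.finite_range _).union
      ((Set.finite_range _).union (Set.finite_range _)))))
  obtain ⟨B, P, hP, hSB, hφB, H⟩ := exists_specialization φ hφ hS
  have huB : ∀ i j n, ι (ends τ α i j n) ∈ B := fun i j n => hSB (.inl ⟨(i, j, n), rfl⟩)
  have hpB : ∀ i j, ι (p i j) ∈ B := fun i j => hSB (.inr (.inl ⟨(i, j), rfl⟩))
  have hqB : ∀ i j, ι (q i j) ∈ B := fun i j => hSB (.inr (.inr (.inl ⟨(i, j), rfl⟩)))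
  have hrB : ∀ i j, ι (r i j) ∈ B := fun i j => hSB (.inr (.inr (.inr (.inl ⟨(i, j), rfl⟩))))
  have hNB : ∀ σ c x y, N σ c x y ∈ B := fun σ c x y =>
    hSB (.inr (.inr (.inr (.inr (.inl ⟨(σ, c, x, y), rfl⟩)))))
  have htB : ∀ i j k l m n, (ι (triLines (ends τ α) i j k l m n))⁻¹ ∈ B := fun i j k l m n =>
    hSB (.inr (.inr (.inr (.inr (.inr ⟨(i, j, k, l, m, n), rfl⟩)))))
  have hB : Function.Injective B.subtype := B.subtype_injective
  let v : Fin 8 → Fin 8 → Fin 3 → B := fun i j n => ⟨ι (ends τ α i j n), huB i j n⟩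
  refine ⟨P, hP, fun F hF hFP => ?_⟩
  obtain ⟨ψ, hψ⟩ := H _ hFP
  let u : Fin 8 → Fin 8 → Fin 3 → ℂ := fun i j n => ψ (v i j n)
  have htri : ∀ i j k l m n, triLines (ends τ α) i j k l m n ≠ 0 → triLines u i j k l m n ≠ 0 := by
    intro i j k l m n h h0
    have h1 : triLines v i j k l m n * ⟨_, htB i j k l m n⟩ = 1 := hB (by
      rw [map_mul, map_triLines, map_one]
      change triLines (fun i j n => ι (ends τ α i j n)) i j k l m n * _ = 1
      rw [← map_triLines]
      exact mul_inv_cancel₀ ((map_ne_zero_iff ι hι).2 h))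
    have h2 := congrArg ψ h1
    rw [map_mul, map_one, map_triLines] at h2
    change triLines u i j k l m n * _ = 1 at h2
    rw [h0, zero_mul] at h2
    exact zero_ne_one h2
  have hclique : ∀ σ, HasGoodClique (ends τ α) σ → HasGoodClique u σ := by
    rintro σ ⟨f, g, e, h1, h2, h3⟩
    exact ⟨f, g, e, h1, h2, fun a b c hab hac hbc => htri _ _ _ _ _ _ (h3 a b c hab hac hbc)⟩
  have hNu : ∀ σ (c : Fin 2), SignSymm σ → ¬ HasGoodClique u σ → (IsSteiner σ → c = 1) →
      ∃ N, IsLeftInv u σ ((c : ℕ) : ℤ) N := fun σ c h1 h2 h3 => by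
    have h4 : IsLeftInv v σ ((c : ℕ) : ℤ) fun x y => ⟨N σ c x y, hNB σ c x y⟩ :=
      IsLeftInv.of_map hB (hN σ c h1 (fun h => h2 (hclique σ h)) h3)
    exact ⟨_, h4.map ψ⟩
  have hgen : IsGeneralConfig u :=
    { star := fun i j k l hj hk hl hjk hjl hkl =>
        htri _ _ _ _ _ _ (hu.triLines_star hj hk hl hjk hjl hkl)
      steiner := fun σ h1 h2 _ => by simpa using hNu σ 1 h1 h2 fun _ => rfl
      not_steiner := fun σ h1 h2 h3 => by simpa using hNu σ 0 h1 h2 fun h => absurd h h3 }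
  refine ⟨u, hgen, fun i j hij => ?_⟩
  have hsqB : IsSquareOn (fun n => (⟨φ (MvPolynomial.X (idx n)), hφB _⟩ : B)) (v i j) (v j i)
      ⟨_, hpB i j⟩ ⟨_, hqB i j⟩ ⟨_, hrB i j⟩ := by
    refine IsSquareOn.of_map hB ?_
    have := (hpqr i j hij).map ι
    simp only [← hφm] at this
    exact this
  have hsqF := hsqB.map ψ
  have hc : (fun n => ψ ⟨φ (MvPolynomial.X (idx n)), hφB _⟩)
      = fun n => F.coeff (quarticExp n).1 := funext fun n => by
    rw [hψ, MvPolynomial.eval_X]; rfl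
  rw [hc] at hsqF
  refine isBitangent_lineThrough (hgen.lineThrough_ne_zero hij) (p := ψ ⟨_, hpB i j⟩)
    (q := ψ ⟨_, hqB i j⟩) (r := ψ ⟨_, hrB i j⟩) fun s t => ?_
  rw [hF.eval_eq_quartic]
  exact hsqF.eq s t

/-- Caporaso–Sernesi: the general plane quartic is uniquely determined by its 28
bitangent lines. There is a nonzero polynomial `P` in the 15 coefficients of a
plane quartic such that any two smooth quartics not annihilating `P` with the
same set of bitangent lines are proportional. -/
theorem caporaso_sernesi :
    ∃ P : MvPolynomial {d : Fin 3 →₀ ℕ // ∑ i, d i = 4} ℂ, P ≠ 0 ∧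
      ∀ F G : MvPolynomial (Fin 3) ℂ,
        SmoothQuartic F → SmoothQuartic G →
        MvPolynomial.eval (fun d => F.coeff d.1) P ≠ 0 →
        MvPolynomial.eval (fun d => G.coeff d.1) P ≠ 0 →
        {L : Fin 3 → ℂ | IsBitangent F L} = {L : Fin 3 → ℂ | IsBitangent G L} →
        ∃ c : ℂ, c ≠ 0 ∧ G = c • F := by
  obtain ⟨P, hP, h⟩ := exists_isGeneralConfig
  refine ⟨P, hP, fun F G hF hG hFP _ hFG => ?_⟩
  obtain ⟨u, hu, hFu⟩ := h F hF.2.1 hFP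
  exact hu.eq_smul hF hG hFu fun i j hij => (Set.ext_iff.1 hFG _).1 (hFu i j hij)
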